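/- arXiv:1806.03135 — 2 statements merged into one kernel-verified Lean document; each statement's English description precedes it below -/
import Mathlib

section
/- Assume (H0) and (H1) hold for V with parameters D, C, s, let δ_n = n^{−α} with 0 < α ≤ 1, and let a be a variation sequence of length L and order M with M > D; set n' = n − L + 1. Then: (i) (−1)^D R(0,1,2D,|·|^s,a^{2*}) > 0; (ii) the quantity E_n := −n' Σ_j (a^{2*})_j V(j δ_n), which equals the expectation E[V_{a,n}] of the quadratic a-variation of a centered Gaussian process with semi-variogram V, satisfies E_n / ( n C (−1)^D δ_n^{2D+s} R(0,1,2D,|·|^s,a^{2*}) ) → 1 as n → ∞. -/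
open Filter MeasureTheory

/-- Convolution of finitely supported sequences: `(a*a')_m = Σ_{k-l=m} a_k a'_l`. -/
noncomputable def seqConv (a a' : ℤ → ℝ) (m : ℤ) : ℝ := ∑ᶠ k : ℤ, a k * a' (k - m)

/-- `R(i,δ,q,f,c) = −Σ_j c_j j^q ∫_0^1 ((1−η)^{q−1}/(q−1)!) f((i+jη)δ) dη` for `q ≥ 1`,
and `R(i,δ,0,f,c) = −Σ_j c_j f((i+j)δ)`. -/
noncomputable def Rq (i : ℤ) (δ : ℝ) (q : ℕ) (f : ℝ → ℝ) (c : ℤ → ℝ) : ℝ :=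
  if q = 0 then -∑ᶠ j : ℤ, c j * f ((i + j) * δ)
  else -∑ᶠ j : ℤ, c j * (j : ℝ) ^ q *
    ∫ η in (0:ℝ)..1, ((1 - η) ^ (q - 1) / (Nat.factorial (q - 1) : ℝ)) * f ((i + j * η) * δ)

theorem finsum_seqConv_mul (S : Finset ℤ) (a : ℤ → ℝ) (ha : ∀ j, j ∉ S → a j = 0)
    (f : ℤ → ℝ) :
    ∑ᶠ j : ℤ, seqConv a a j * f j = ∑ k ∈ S, ∑ l ∈ S, a k * a l * f (k - l) := by
  have hconv (m : ℤ) : seqConv a a m = ∑ k ∈ S, a k * a (k - m) := by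
    refine finsum_eq_sum_of_support_subset _ fun k hk => ?_
    by_contra h
    exact hk (by simp [ha k h])
  simp_rw [hconv, Finset.sum_mul]
  rw [finsum_sum_comm]
  · refine Finset.sum_congr rfl fun k _ => ?_
    rw [← finsum_comp_equiv (Equiv.subLeft k)]
    simp only [Equiv.subLeft_apply, sub_sub_cancel]
    refine finsum_eq_sum_of_support_subset _ fun l hl => ?_
    by_contra h
    exact hl (by simp [ha l h])
  · intro k _
    refine (S.finite_toSet.preimage (f := fun m => k - m)
      (fun x _ y _ h => sub_right_injective h)).subset fun m hm => ?_
    by_contra h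
    exact hm (by simp [ha (k - m) h])

theorem sum_sum_mul_sub_pow_eq_zero (S : Finset ℤ) (a : ℤ → ℝ) {M p : ℕ}
    (hmom : ∀ k < M, ∑ j ∈ S, a j * (j : ℝ) ^ k = 0) (hp : p < 2 * M) :
    ∑ k ∈ S, ∑ l ∈ S, a k * a l * ((k : ℝ) - l) ^ p = 0 := by
  have expand (k l : ℤ) : a k * a l * ((k : ℝ) - l) ^ p = ∑ i ∈ Finset.range (p + 1),
      ((-1) ^ (p - i) * (p.choose i : ℝ)) * ((a k * (k : ℝ) ^ i) * (a l * (l : ℝ) ^ (p - i))) := by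
    rw [sub_eq_add_neg, add_pow, Finset.mul_sum]
    refine Finset.sum_congr rfl fun i _ => ?_
    rw [neg_pow (l : ℝ)]
    ring
  simp_rw [expand]
  simp_rw [Finset.sum_comm (s := S) (t := Finset.range (p + 1)), ← Finset.mul_sum,
    ← Finset.sum_mul]
  refine Finset.sum_eq_zero fun i hi => ?_
  rcases lt_or_ge i M with h | h
  · rw [hmom i h]; simp
  · rw [hmom (p - i) (by have := Finset.mem_range.1 hi; omega)]; simp

/-- The remainder of the Taylor expansion of `cos` to order `2 * D` at `0`, with the sign that
makes it nonnegative. -/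
noncomputable def cosRem (D : ℕ) (x : ℝ) : ℝ :=
  (-1) ^ (D + 1) * (Real.cos x
    - ∑ i ∈ Finset.range (D + 1), (-1) ^ i * x ^ (2 * i) / ((2 * i).factorial : ℝ))

/-- The remainder of the Taylor expansion of `sin` to order `2 * D + 1` at `0`, with the sign that
makes it nonnegative on `[0, ∞)`. -/
noncomputable def sinRem (D : ℕ) (x : ℝ) : ℝ :=
  (-1) ^ (D + 1) * (Real.sin x
    - ∑ i ∈ Finset.range (D + 1), (-1) ^ i * x ^ (2 * i + 1) / ((2 * i + 1).factorial : ℝ))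

theorem hasDerivAt_sinRem (D : ℕ) (x : ℝ) : HasDerivAt (sinRem D) (cosRem D x) x := by
  unfold sinRem cosRem
  refine HasDerivAt.const_mul _ ((Real.hasDerivAt_sin x).sub (HasDerivAt.fun_sum fun i _ => ?_))
  refine (((hasDerivAt_pow (2 * i + 1) x).const_mul ((-1 : ℝ) ^ i)).div_const _).congr_deriv ?_
  rw [Nat.factorial_succ]
  push_cast
  have : ((2 * i).factorial : ℝ) ≠ 0 := by positivity
  have : (2 * i + 1 : ℝ) ≠ 0 := by positivity
  field_simp

theorem hasDerivAt_cosRem_succ (D : ℕ) (x : ℝ) :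
    HasDerivAt (cosRem (D + 1)) (sinRem D x) x := by
  unfold sinRem cosRem
  simp only [Finset.sum_range_succ' _ (D + 1)]
  have h : HasDerivAt (fun x : ℝ => ∑ i ∈ Finset.range (D + 1),
      (-1) ^ (i + 1) * x ^ (2 * (i + 1)) / ((2 * (i + 1)).factorial : ℝ))
      (∑ i ∈ Finset.range (D + 1),
        -((-1) ^ i * x ^ (2 * i + 1) / ((2 * i + 1).factorial : ℝ))) x := by
    refine HasDerivAt.fun_sum fun i _ => ?_
    refine (((hasDerivAt_pow (2 * (i + 1)) x).const_mul
      ((-1 : ℝ) ^ (i + 1))).div_const _).congr_deriv ?_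
    rw [show 2 * (i + 1) = 2 * i + 1 + 1 by ring, Nat.factorial_succ (2 * i + 1)]
    push_cast
    have : ((2 * i + 1).factorial : ℝ) ≠ 0 := by positivity
    have : (2 * i + 1 + 1 : ℝ) ≠ 0 := by positivity
    field_simp
    simp only [pow_succ]
    ring
  simp only [mul_zero, pow_zero]
  refine (((Real.hasDerivAt_cos x).sub (h.add_const _)).const_mul _).congr_deriv ?_
  rw [Finset.sum_neg_distrib]
  ring

theorem continuous_cosRem (D : ℕ) : Continuous (cosRem D) := by
  unfold cosRem
  fun_prop

theorem cosRem_apply_zero (D : ℕ) : cosRem D 0 = 0 := by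
  simp [cosRem, Finset.sum_range_succ']

theorem sinRem_apply_zero (D : ℕ) : sinRem D 0 = 0 := by
  simp [sinRem]

theorem cosRem_abs (D : ℕ) (x : ℝ) : cosRem D |x| = cosRem D x := by
  simp [cosRem, pow_mul, sq_abs]

theorem nonneg_of_hasDerivAt_nonneg {f f' : ℝ → ℝ} (h : ∀ x, HasDerivAt f (f' x) x)
    (h0 : f 0 = 0) (hf' : ∀ x, 0 ≤ x → 0 ≤ f' x) {x : ℝ} (hx : 0 ≤ x) : 0 ≤ f x := by
  have hmono : MonotoneOn f (Set.Ici 0) :=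
    monotoneOn_of_hasDerivWithinAt_nonneg (convex_Ici 0)
      (fun y _ => (h y).continuousAt.continuousWithinAt) (fun y _ => (h y).hasDerivWithinAt)
      fun y hy => hf' y (interior_subset hy)
  simpa [h0] using hmono Set.self_mem_Ici hx hx

theorem cosRem_nonneg (D : ℕ) {x : ℝ} (hx : 0 ≤ x) : 0 ≤ cosRem D x := by
  induction D generalizing x with
  | zero => simp [cosRem, Real.cos_le_one]
  | succ D ih =>
    exact nonneg_of_hasDerivAt_nonneg (hasDerivAt_cosRem_succ D) (cosRem_apply_zero _)
      (fun y hy => nonneg_of_hasDerivAt_nonneg (hasDerivAt_sinRem D) (sinRem_apply_zero D)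
        (fun z hz => ih hz) hy) hx

theorem cosRem_add_cosRem_succ (D : ℕ) (x : ℝ) :
    cosRem D x + cosRem (D + 1) x = x ^ (2 * (D + 1)) / ((2 * (D + 1)).factorial : ℝ) := by
  unfold cosRem
  rw [Finset.sum_range_succ _ (D + 1)]
  have h : ((-1 : ℝ) ^ (D + 1)) * (-1) ^ (D + 1) = 1 := by
    rw [← mul_pow]; simp
  rw [pow_succ (-1 : ℝ) (D + 1)]
  linear_combination (x ^ (2 * (D + 1)) / ((2 * (D + 1)).factorial : ℝ)) * h

theorem pow_div_factorial_le {x : ℝ} (hx : 0 ≤ x) (n : ℕ) : x ^ n / (n.factorial : ℝ) ≤ x ^ n :=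
  div_le_self (by positivity) (by exact_mod_cast n.factorial_pos)

theorem cosRem_le_pow_succ (D : ℕ) {x : ℝ} (hx : 0 ≤ x) : cosRem D x ≤ x ^ (2 * (D + 1)) := by
  have := cosRem_add_cosRem_succ D x
  have := cosRem_nonneg (D + 1) hx
  have := pow_div_factorial_le hx (2 * (D + 1))
  linarith

theorem cosRem_le_two_mul_pow (D : ℕ) {x : ℝ} (hx : 0 ≤ x) : cosRem D x ≤ 2 * x ^ (2 * D) := by
  cases D with
  | zero =>
    simp only [cosRem, zero_add, Finset.range_one, Finset.sum_singleton, mul_zero, pow_zero,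
      Nat.factorial_zero, Nat.cast_one, pow_one]
    linarith [Real.neg_one_le_cos x]
  | succ D =>
    have := cosRem_add_cosRem_succ D x
    have := cosRem_nonneg D hx
    have := pow_div_factorial_le hx (2 * (D + 1))
    have : 0 ≤ x ^ (2 * (D + 1)) := by positivity
    linarith

theorem integrableOn_cosRem_mul_rpow (D : ℕ) {s : ℝ} (hs0 : 0 < s) (hs2 : s < 2) :
    IntegrableOn (fun t => cosRem D t * t ^ (-1 - (2 * (D : ℝ) + s))) (Set.Ioi 0) := by
  have hmeas : Measurable fun t : ℝ => cosRem D t * t ^ (-1 - (2 * (D : ℝ) + s)) :=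
    (continuous_cosRem D).measurable.mul (by fun_prop)
  rw [← Set.Ioc_union_Ioi_eq_Ioi zero_le_one]
  refine IntegrableOn.union ?_ ?_
  · have hint : IntegrableOn (fun t : ℝ => t ^ (1 - s)) (Set.Ioc 0 1) :=
      (intervalIntegrable_iff_integrableOn_Ioc_of_le zero_le_one).1
        (intervalIntegral.intervalIntegrable_rpow' (by linarith))
    refine hint.mono' hmeas.aestronglyMeasurable ?_
    filter_upwards [ae_restrict_mem measurableSet_Ioc] with t ht
    have ht0 : 0 < t := ht.1
    rw [Real.norm_of_nonneg (mul_nonneg (cosRem_nonneg D ht0.le) (by positivity))]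
    calc _ ≤ t ^ (2 * (D + 1)) * t ^ (-1 - (2 * (D : ℝ) + s)) := by
          gcongr
          exact cosRem_le_pow_succ D ht0.le
      _ = t ^ (1 - s) := by
          rw [← Real.rpow_natCast, ← Real.rpow_add ht0]
          congr 1
          push_cast
          ring
  · have hint : IntegrableOn (fun t : ℝ => 2 * t ^ (-1 - s)) (Set.Ioi 1) :=
      (integrableOn_Ioi_rpow_of_lt (by linarith) zero_lt_one).const_mul 2
    refine hint.mono' hmeas.aestronglyMeasurable ?_
    filter_upwards [ae_restrict_mem measurableSet_Ioi] with t ht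
    have ht0 : 0 < t := zero_lt_one.trans ht
    rw [Real.norm_of_nonneg (mul_nonneg (cosRem_nonneg D ht0.le) (by positivity))]
    calc _ ≤ 2 * t ^ (2 * D) * t ^ (-1 - (2 * (D : ℝ) + s)) := by
          gcongr
          exact cosRem_le_two_mul_pow D ht0.le
      _ = 2 * t ^ (-1 - s) := by
          rw [← Real.rpow_natCast, mul_assoc, ← Real.rpow_add ht0]
          congr 2
          push_cast
          ring

theorem cosRem_mul_rpow_scale (D : ℕ) (β : ℝ) {b t : ℝ} (hb : 0 < b) (ht : 0 < t) :
    cosRem D (b * t) * t ^ (-1 - β)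
      = b ^ (1 + β) * (cosRem D (b * t) * (b * t) ^ (-1 - β)) := by
  rw [Real.mul_rpow hb.le ht.le, show -1 - β = -(1 + β) by ring, Real.rpow_neg hb.le]
  have := (Real.rpow_pos_of_pos hb (1 + β)).ne'
  field_simp

theorem integrableOn_cosRem_mul_left (D : ℕ) {s : ℝ} (hs0 : 0 < s) (hs2 : s < 2) (x : ℝ) :
    IntegrableOn (fun t => cosRem D (x * t) * t ^ (-1 - (2 * (D : ℝ) + s))) (Set.Ioi 0) := by
  rcases eq_or_ne x 0 with rfl | hx
  · simp [cosRem_apply_zero]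
  have hb : 0 < |x| := abs_pos.2 hx
  have h := (integrableOn_Ioi_comp_mul_left_iff
    (fun t => cosRem D t * t ^ (-1 - (2 * (D : ℝ) + s))) 0 hb).2 (by
      simpa using integrableOn_cosRem_mul_rpow D hs0 hs2)
  refine IntegrableOn.congr_fun (h.const_mul (|x| ^ (1 + (2 * (D : ℝ) + s)))) (fun t ht => ?_) measurableSet_Ioi
  have ht : 0 < t := ht
  rw [← cosRem_mul_rpow_scale D _ hb ht, ← cosRem_abs D (x * t), abs_mul, abs_of_pos ht]

theorem integral_cosRem_mul_left (D : ℕ) {s : ℝ} (hs0 : 0 < s) (x : ℝ) :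
    ∫ t in Set.Ioi (0 : ℝ), cosRem D (x * t) * t ^ (-1 - (2 * (D : ℝ) + s))
      = |x| ^ (2 * (D : ℝ) + s)
        * ∫ t in Set.Ioi (0 : ℝ), cosRem D t * t ^ (-1 - (2 * (D : ℝ) + s)) := by
  have hβ : 0 < 2 * (D : ℝ) + s := by positivity
  rcases eq_or_ne x 0 with rfl | hx
  · simp [cosRem_apply_zero, Real.zero_rpow hβ.ne']
  have hb : 0 < |x| := abs_pos.2 hx
  have h : ∀ t ∈ Set.Ioi (0 : ℝ), cosRem D (x * t) * t ^ (-1 - (2 * (D : ℝ) + s))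
      = |x| ^ (1 + (2 * (D : ℝ) + s))
        * (fun u => cosRem D u * u ^ (-1 - (2 * (D : ℝ) + s))) (|x| * t) := by
    intro t ht
    have ht : 0 < t := ht
    simp only
    rw [← cosRem_mul_rpow_scale D _ hb ht, ← cosRem_abs D (x * t), abs_mul, abs_of_pos ht]
  rw [setIntegral_congr_fun measurableSet_Ioi h, integral_const_mul,
    integral_comp_mul_left_Ioi (fun u => cosRem D u * u ^ (-1 - (2 * (D : ℝ) + s))) _ hb, Real.rpow_add hb, mul_zero, Real.rpow_one, smul_eq_mul]
  field_simp

theorem sum_sum_mul_cos_sub (S : Finset ℤ) (a : ℤ → ℝ) (t : ℝ) :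
    ∑ k ∈ S, ∑ l ∈ S, a k * a l * Real.cos (((k : ℝ) - l) * t)
      = (∑ k ∈ S, a k * Real.cos (k * t)) ^ 2 + (∑ k ∈ S, a k * Real.sin (k * t)) ^ 2 := by
  simp_rw [sq, Finset.sum_mul_sum, ← Finset.sum_add_distrib]
  refine Finset.sum_congr rfl fun k _ => Finset.sum_congr rfl fun l _ => ?_
  rw [sub_mul, Real.cos_sub]
  ring

theorem exists_pos_sum_sum_mul_cos_sub (S : Finset ℤ) (a : ℤ → ℝ) (ha : ∃ k ∈ S, a k ≠ 0) :
    ∃ t > 0, 0 < ∑ k ∈ S, ∑ l ∈ S, a k * a l * Real.cos (((k : ℝ) - l) * t) := by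
  by_contra! h
  have hcos (m : ℤ) : ∫ t in (0 : ℝ)..2 * Real.pi, Real.cos ((m : ℝ) * t)
      = if m = 0 then 2 * Real.pi else 0 := by
    split_ifs with hm
    · simp [hm]
    · rw [intervalIntegral.integral_comp_mul_left _ (by exact_mod_cast hm), integral_cos]
      have : Real.sin ((m : ℝ) * (2 * Real.pi)) = 0 := by
        rw [show (m : ℝ) * (2 * Real.pi) = ((m * 2 : ℤ) : ℝ) * Real.pi by push_cast; ring]
        exact Real.sin_int_mul_pi _
      simp [this]
  have hint : ∫ t in (0 : ℝ)..2 * Real.pi,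
      ∑ k ∈ S, ∑ l ∈ S, a k * a l * Real.cos (((k : ℝ) - l) * t)
      = 2 * Real.pi * ∑ k ∈ S, a k ^ 2 := by
    rw [intervalIntegral.integral_finsetSum fun k _ => by
      apply Continuous.intervalIntegrable; fun_prop]
    rw [Finset.mul_sum]
    refine Finset.sum_congr rfl fun k hk => ?_
    rw [intervalIntegral.integral_finsetSum fun l _ => by
      apply Continuous.intervalIntegrable; fun_prop]
    have hterm (l : ℤ) : ∫ t in (0 : ℝ)..2 * Real.pi, a k * a l * Real.cos (((k : ℝ) - l) * t)
        = if k = l then 2 * Real.pi * a k ^ 2 else 0 := by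
      have := hcos (k - l)
      push_cast at this
      rw [intervalIntegral.integral_const_mul, this]
      by_cases hkl : k = l
      · simp [hkl]; ring
      · simp [hkl, sub_eq_zero]
    simp [hterm, hk]
  have hle : ∫ t in (0 : ℝ)..2 * Real.pi,
      ∑ k ∈ S, ∑ l ∈ S, a k * a l * Real.cos (((k : ℝ) - l) * t) = 0 := by
    refine intervalIntegral.integral_zero_ae (Eventually.of_forall fun t ht => ?_)
    rw [Set.uIoc_of_le (by positivity)] at ht
    refine le_antisymm (h t ht.1) ?_
    rw [sum_sum_mul_cos_sub]
    positivity
  obtain ⟨k, hk, hak⟩ := ha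
  have : 0 < ∑ k ∈ S, a k ^ 2 := Finset.sum_pos' (fun _ _ => sq_nonneg _) ⟨k, hk, by positivity⟩
  rw [hint] at hle
  have : 0 < 2 * Real.pi * ∑ k ∈ S, a k ^ 2 := by positivity
  linarith

/-- Strict conditional definiteness of the power kernel `|x - y| ^ (2 * D + s)` on the vectors whose
moments of order at most `D` vanish. -/
theorem sum_sum_mul_abs_sub_rpow_pos (S : Finset ℤ) (a : ℤ → ℝ) (ha : ∃ k ∈ S, a k ≠ 0)
    {D M : ℕ} (hmom : ∀ k < M, ∑ j ∈ S, a j * (j : ℝ) ^ k = 0) (hDM : D < M)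
    {s : ℝ} (hs0 : 0 < s) (hs2 : s < 2) :
    0 < (-1) ^ (D + 1) * ∑ k ∈ S, ∑ l ∈ S, a k * a l * |(k : ℝ) - l| ^ (2 * (D : ℝ) + s) := by
  set β := 2 * (D : ℝ) + s with hβ
  set P : ℝ → ℝ := fun t => ∑ k ∈ S, ∑ l ∈ S, a k * a l * Real.cos (((k : ℝ) - l) * t) with hP
  set K := ∫ t in Set.Ioi (0 : ℝ), cosRem D t * t ^ (-1 - β) with hK
  have hsign : ((-1 : ℝ) ^ (D + 1)) * (-1) ^ (D + 1) = 1 := by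
    rw [← mul_pow]; simp
  have hPcos (t : ℝ) : P t = ∑ k ∈ S, ∑ l ∈ S,
      (-1) ^ (D + 1) * (a k * a l * cosRem D (((k : ℝ) - l) * t)) := by
    have hpoly : ∑ k ∈ S, ∑ l ∈ S, a k * a l * ∑ i ∈ Finset.range (D + 1),
        (-1) ^ i * (((k : ℝ) - l) * t) ^ (2 * i) / ((2 * i).factorial : ℝ) = 0 := by
      simp_rw [Finset.mul_sum, Finset.sum_comm (s := S) (t := Finset.range (D + 1))]
      refine Finset.sum_eq_zero fun i hi => ?_
      have := sum_sum_mul_sub_pow_eq_zero S a hmom (p := 2 * i)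
        (by have := Finset.mem_range.1 hi; omega)
      calc _ = ((-1) ^ i * t ^ (2 * i) / ((2 * i).factorial : ℝ)) *
            ∑ k ∈ S, ∑ l ∈ S, a k * a l * ((k : ℝ) - l) ^ (2 * i) := by
            simp_rw [Finset.mul_sum]
            refine Finset.sum_congr rfl fun k _ => Finset.sum_congr rfl fun l _ => ?_
            rw [mul_pow]
            ring
        _ = 0 := by rw [this, mul_zero]
    rw [← sub_zero (P t), ← hpoly]
    simp only [hP, ← Finset.sum_sub_distrib]
    refine Finset.sum_congr rfl fun k _ => Finset.sum_congr rfl fun l _ => ?_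
    unfold cosRem
    linear_combination (-a k * a l * (Real.cos (((k : ℝ) - l) * t) - ∑ i ∈ Finset.range (D + 1),
        (-1) ^ i * (((k : ℝ) - l) * t) ^ (2 * i) / ((2 * i).factorial : ℝ))) * hsign
  have hterm (k l : ℤ) : IntegrableOn (fun t =>
      (-1) ^ (D + 1) * (a k * a l) * (cosRem D (((k : ℝ) - l) * t) * t ^ (-1 - β)))
      (Set.Ioi 0) :=
    (integrableOn_cosRem_mul_left D hs0 hs2 _).const_mul _
  have hPexp : (fun t => P t * t ^ (-1 - β)) = fun t => ∑ k ∈ S, ∑ l ∈ S,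
      (-1) ^ (D + 1) * (a k * a l) * (cosRem D (((k : ℝ) - l) * t) * t ^ (-1 - β)) := by
    funext t
    rw [hPcos]
    simp_rw [Finset.sum_mul]
    refine Finset.sum_congr rfl fun k _ => Finset.sum_congr rfl fun l _ => ?_
    ring
  have hPint : IntegrableOn (fun t => P t * t ^ (-1 - β)) (Set.Ioi 0) := by
    rw [hPexp]
    exact integrable_finsetSum _ fun k _ => integrable_finsetSum _ fun l _ => hterm k l
  have hint : ∫ t in Set.Ioi (0 : ℝ), P t * t ^ (-1 - β)
      = K * ((-1) ^ (D + 1) * ∑ k ∈ S, ∑ l ∈ S, a k * a l * |(k : ℝ) - l| ^ β) := by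
    rw [hPexp, integral_finsetSum _ fun k _ => integrable_finsetSum _ fun l _ => hterm k l]
    simp_rw [Finset.mul_sum]
    refine Finset.sum_congr rfl fun k _ => ?_
    rw [integral_finsetSum _ fun l _ => hterm k l]
    refine Finset.sum_congr rfl fun l _ => ?_
    rw [integral_const_mul, hβ, integral_cosRem_mul_left D hs0]
    ring
  have hPnonneg (t : ℝ) : 0 ≤ P t := by
    simp only [hP, sum_sum_mul_cos_sub]
    positivity
  have hPcont : Continuous P := by fun_prop
  have hpos : 0 < ∫ t in Set.Ioi (0 : ℝ), P t * t ^ (-1 - β) := by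
    rw [setIntegral_pos_iff_support_of_nonneg_ae _ hPint]
    · obtain ⟨t, ht, hPt⟩ := exists_pos_sum_sum_mul_cos_sub S a ha
      have hopen : IsOpen ({t | 0 < P t} ∩ Set.Ioi 0) :=
        (isOpen_lt continuous_const hPcont).inter isOpen_Ioi
      refine (hopen.measure_pos volume ⟨t, hPt, ht⟩).trans_le (measure_mono ?_)
      rintro u ⟨hu, hu0⟩
      exact ⟨(mul_pos hu (Real.rpow_pos_of_pos hu0 _)).ne', hu0⟩
    · filter_upwards [ae_restrict_mem measurableSet_Ioi] with t ht
      exact mul_nonneg (hPnonneg t) (Real.rpow_nonneg (le_of_lt ht) _)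
  have hKnonneg : 0 ≤ K := setIntegral_nonneg measurableSet_Ioi fun t ht =>
    mul_nonneg (cosRem_nonneg D (le_of_lt ht)) (Real.rpow_nonneg (le_of_lt ht) _)
  rw [hint] at hpos
  exact pos_of_mul_pos_right hpos hKnonneg

/-- The coefficient of `|x| ^ (2 * D + s)` in the `2 * D`-fold primitive of `|x| ^ s`. -/
noncomputable def taylorConst (D : ℕ) (s : ℝ) : ℝ :=
  if 2 * D = 0 then 1
  else ∫ η in (0 : ℝ)..1, ((1 - η) ^ (2 * D - 1) / ((2 * D - 1).factorial : ℝ)) * η ^ s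

theorem taylorConst_pos (D : ℕ) {s : ℝ} (hs : 0 < s) : 0 < taylorConst D s := by
  unfold taylorConst
  split_ifs
  · exact one_pos
  · refine intervalIntegral.intervalIntegral_pos_of_pos_on ?_ (fun η hη => ?_) zero_lt_one
    · refine Continuous.intervalIntegrable ?_ _ _
      have := Real.continuous_rpow_const hs.le
      fun_prop
    · have : 0 < 1 - η := sub_pos.2 hη.2
      have : 0 < η := hη.1
      positivity

theorem abs_two_mul_rpow (D : ℕ) {s : ℝ} (hs : 0 < s) (x : ℝ) :
    x ^ (2 * D) * |x| ^ s = |x| ^ (2 * (D : ℝ) + s) := by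
  have h : x ^ (2 * D) = |x| ^ (2 * (D : ℝ)) := by
    rw [← Even.pow_abs (even_two_mul D), ← Real.rpow_natCast]
    norm_cast
  rw [h, ← Real.rpow_add_of_nonneg (abs_nonneg x) (by positivity) hs.le]

theorem Rq_abs_rpow (D : ℕ) {s : ℝ} (hs : 0 < s) (c : ℤ → ℝ) :
    Rq 0 1 (2 * D) (fun x => |x| ^ s) c
      = -(taylorConst D s * ∑ᶠ j : ℤ, c j * |(j : ℝ)| ^ (2 * (D : ℝ) + s)) := by
  unfold Rq taylorConst
  split_ifs with h
  · obtain rfl : D = 0 := by omega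
    simp
  · rw [mul_finsum]
    congr 2
    funext j
    have hint : ∫ η in (0 : ℝ)..1, ((1 - η) ^ (2 * D - 1) / ((2 * D - 1).factorial : ℝ))
          * |(((0 : ℤ) : ℝ) + j * η) * 1| ^ s
        = |(j : ℝ)| ^ s * ∫ η in (0 : ℝ)..1,
          ((1 - η) ^ (2 * D - 1) / ((2 * D - 1).factorial : ℝ)) * η ^ s := by
      rw [← intervalIntegral.integral_const_mul]
      refine intervalIntegral.integral_congr fun η hη => ?_
      rw [Set.uIcc_of_le zero_le_one] at hη
      simp only [Int.cast_zero, zero_add, mul_one]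
      rw [abs_mul, abs_of_nonneg hη.1, Real.mul_rpow (abs_nonneg _) hη.1]
      ring
    rw [hint, ← abs_two_mul_rpow D hs]
    ring

/-- A function whose derivative of order `2 * D` is `A + B * |h| ^ s + o(|h| ^ s)` at `0` is, up to
`o(|x| ^ (2 * D + s))`, the sum of a polynomial of degree at most `2 * D` and of a multiple of
`|x| ^ (2 * D + s)`. -/
theorem exists_taylor_isLittleO_abs_rpow {V r : ℝ → ℝ} {D : ℕ} {A B s : ℝ} (hs : 0 < s)
    (hV : ContDiff ℝ ((2 * D : ℕ) : ℕ∞) V)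
    (hExp : ∀ h : ℝ, iteratedDeriv (2 * D) V h = A + B * |h| ^ s + r h)
    (hro : r =o[nhds (0 : ℝ)] fun h => |h| ^ s) :
    ∃ c : ℕ → ℝ, (fun x => V x - ∑ i ∈ Finset.range (2 * D + 1), c i * x ^ i
        - B * taylorConst D s * |x| ^ (2 * (D : ℝ) + s))
      =o[nhds (0 : ℝ)] fun x => |x| ^ (2 * (D : ℝ) + s) := by
  rcases Nat.eq_zero_or_pos D with rfl | hD
  · refine ⟨fun _ => A, ?_⟩
    simp only [mul_zero, iteratedDeriv_zero] at hExp
    refine hro.congr (fun x => ?_) fun x => ?_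
    · simp [taylorConst, hExp]
      ring
    · simp
  obtain ⟨d, hd⟩ : ∃ d, 2 * D = d + 1 := ⟨2 * D - 1, by omega⟩
  have hcont : Continuous (iteratedDeriv (d + 1) V) := by
    refine ContDiff.continuous_iteratedDeriv (d + 1) hV ?_
    rw [hd]
    exact le_rfl
  have hspow := Real.continuous_rpow_const hs.le
  rw [hd] at hExp
  have hrcont : Continuous r := by
    have : r = fun h => iteratedDeriv (d + 1) V h - (A + B * |h| ^ s) := by
      funext h; rw [hExp]; ring
    rw [this]
    fun_prop
  set w : ℝ → ℝ := fun η => (1 - η) ^ d / (d.factorial : ℝ) with hw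
  have hwcont : Continuous w := by fun_prop
  have hTaylor (x : ℝ) : V x = ∑ i ∈ Finset.range (d + 1),
        ((i.factorial : ℝ)⁻¹ * iteratedDeriv i V 0) * x ^ i
      + x ^ (d + 1) * ∫ η in (0 : ℝ)..1, w η * iteratedDeriv (d + 1) V (x * η) := by
    have h := map_add_eq_sum_add_integral_iteratedFDeriv (f := V) (x := 0) (y := x) (n := d)
      fun t _ => by
        have := hV.contDiffAt (x := 0 + t • x)
        rw [hd] at this
        exact_mod_cast this
    simp only [zero_add, iteratedFDeriv_apply_eq_iteratedDeriv_mul_prod, Finset.prod_const,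
      Finset.card_univ, Fintype.card_fin, smul_eq_mul] at h
    rw [h, ← intervalIntegral.integral_const_mul, ← intervalIntegral.integral_const_mul]
    congr 1
    · exact Finset.sum_congr rfl fun i _ => by ring
    · refine intervalIntegral.integral_congr fun η _ => ?_
      simp only [hw]
      rw [mul_comm η x]
      ring
  have hK : taylorConst D s = ∫ η in (0 : ℝ)..1, w η * η ^ s := by
    have : 2 * D ≠ 0 := by omega
    simp [taylorConst, hd, hw]
  have hsplit (x : ℝ) : ∫ η in (0 : ℝ)..1, w η * iteratedDeriv (d + 1) V (x * η)
      = A * (∫ η in (0 : ℝ)..1, w η) + B * taylorConst D s * |x| ^ s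
        + ∫ η in (0 : ℝ)..1, w η * r (x * η) := by
    rw [hK, mul_assoc, mul_comm _ (|x| ^ s), ← mul_assoc, ← intervalIntegral.integral_const_mul,
      ← intervalIntegral.integral_const_mul, ← intervalIntegral.integral_add,
      ← intervalIntegral.integral_add]
    · refine intervalIntegral.integral_congr fun η hη => ?_
      rw [Set.uIcc_of_le zero_le_one] at hη
      rw [hExp, abs_mul, abs_of_nonneg hη.1, Real.mul_rpow (abs_nonneg _) hη.1]
      ring
    all_goals
      refine Continuous.intervalIntegrable ?_ _ _
      fun_prop
  have hrem : (fun x => ∫ η in (0 : ℝ)..1, w η * r (x * η)) =o[nhds (0 : ℝ)]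
      fun x => |x| ^ s := by
    rw [Asymptotics.isLittleO_iff]
    intro ε hε
    obtain ⟨ρ, hρ, hball⟩ := Metric.eventually_nhds_iff.1 (Asymptotics.isLittleO_iff.1 hro hε)
    filter_upwards [Metric.ball_mem_nhds (0 : ℝ) hρ] with x hx
    have hx' : |x| < ρ := by simpa using hx
    have hbound : ∀ η ∈ Set.uIoc (0 : ℝ) 1, ‖w η * r (x * η)‖ ≤ ε * ‖|x| ^ s‖ := by
      intro η hη
      rw [Set.uIoc_of_le zero_le_one] at hη
      have hxη : |x * η| ≤ |x| := by
        rw [abs_mul, abs_of_pos hη.1]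
        exact mul_le_of_le_one_right (abs_nonneg x) hη.2
      have hw1 : ‖w η‖ ≤ 1 := by
        have h0 : 0 ≤ 1 - η := sub_nonneg.2 hη.2
        have h1 : (1 - η) ^ d ≤ 1 := pow_le_one₀ h0 (by linarith [hη.1])
        rw [Real.norm_of_nonneg (by positivity)]
        exact div_le_one_of_le₀ (h1.trans (by exact_mod_cast d.factorial_pos)) (by positivity)
      have hr1 : ‖r (x * η)‖ ≤ ε * ‖|x * η| ^ s‖ :=
        hball (by simpa using hxη.trans_lt hx')
      rw [norm_mul]
      calc _ ≤ 1 * (ε * ‖|x * η| ^ s‖) := by gcongr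
        _ ≤ ε * ‖|x| ^ s‖ := by
          rw [one_mul, Real.norm_of_nonneg (by positivity), Real.norm_of_nonneg (by positivity)]
          gcongr
    simpa using intervalIntegral.norm_integral_le_of_norm_le_const hbound
  refine ⟨fun i => if i < d + 1 then (i.factorial : ℝ)⁻¹ * iteratedDeriv i V 0
    else A * ∫ η in (0 : ℝ)..1, w η, ?_⟩
  have hO := (Asymptotics.isBigO_refl (fun x : ℝ => x ^ (2 * D)) (nhds 0)).mul_isLittleO hrem
  refine hO.congr (fun x => ?_) (fun x => abs_two_mul_rpow D hs x)
  rw [← abs_two_mul_rpow D hs, hd, Finset.sum_range_succ, hTaylor, hsplit]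
  have hcoef : ∑ i ∈ Finset.range (d + 1), (if i < d + 1 then
      (i.factorial : ℝ)⁻¹ * iteratedDeriv i V 0 else A * ∫ η in (0 : ℝ)..1, w η) * x ^ i
      = ∑ i ∈ Finset.range (d + 1), ((i.factorial : ℝ)⁻¹ * iteratedDeriv i V 0) * x ^ i :=
    Finset.sum_congr rfl fun i hi => by rw [if_pos (Finset.mem_range.1 hi)]
  rw [hcoef]
  simp only [lt_irrefl, if_false]
  ring

/-- Small-scale asymptotics of the quadratic form associated with the variation sequence. -/
theorem sum_sum_mul_isLittleO {V : ℝ → ℝ} {D M : ℕ} {B s : ℝ} {c : ℕ → ℝ}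
    (hV : (fun x => V x - ∑ i ∈ Finset.range (2 * D + 1), c i * x ^ i
        - B * |x| ^ (2 * (D : ℝ) + s)) =o[nhds (0 : ℝ)] fun x => |x| ^ (2 * (D : ℝ) + s))
    (S : Finset ℤ) (a : ℤ → ℝ) (hmom : ∀ k < M, ∑ j ∈ S, a j * (j : ℝ) ^ k = 0) (hDM : D < M) :
    (fun δ => ∑ k ∈ S, ∑ l ∈ S, a k * a l * V (((k : ℝ) - l) * δ)
        - B * (∑ k ∈ S, ∑ l ∈ S, a k * a l * |(k : ℝ) - l| ^ (2 * (D : ℝ) + s))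
          * |δ| ^ (2 * (D : ℝ) + s))
      =o[nhds (0 : ℝ)] fun δ => |δ| ^ (2 * (D : ℝ) + s) := by
  set β := 2 * (D : ℝ) + s
  set e : ℝ → ℝ := fun x => V x - ∑ i ∈ Finset.range (2 * D + 1), c i * x ^ i - B * |x| ^ β
    with he
  have hscale (x : ℝ) : (fun δ => e (x * δ)) =o[nhds (0 : ℝ)] fun δ => |δ| ^ β := by
    have htend : Tendsto (fun δ : ℝ => x * δ) (nhds 0) (nhds 0) := by
      simpa using (continuous_const_mul x).tendsto 0
    refine (hV.comp_tendsto htend).trans_isBigO ?_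
    refine Asymptotics.IsBigO.of_bound (|x| ^ β) (Eventually.of_forall fun δ => ?_)
    simp only [Function.comp_apply]
    rw [abs_mul, Real.mul_rpow (abs_nonneg _) (abs_nonneg _), norm_mul,
      Real.norm_of_nonneg (by positivity : 0 ≤ |x| ^ β)]
  have hsum : (fun δ => ∑ k ∈ S, ∑ l ∈ S, a k * a l * e (((k : ℝ) - l) * δ))
      =o[nhds (0 : ℝ)] fun δ => |δ| ^ β :=
    Asymptotics.IsLittleO.fun_sum fun k _ => Asymptotics.IsLittleO.fun_sum fun l _ =>
      (hscale _).const_mul_left _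
  refine hsum.congr_left fun δ => ?_
  have hpoly : ∑ k ∈ S, ∑ l ∈ S, a k * a l *
      ∑ i ∈ Finset.range (2 * D + 1), c i * (((k : ℝ) - l) * δ) ^ i = 0 := by
    simp_rw [Finset.mul_sum, Finset.sum_comm (s := S) (t := Finset.range (2 * D + 1))]
    refine Finset.sum_eq_zero fun i hi => ?_
    have := sum_sum_mul_sub_pow_eq_zero S a hmom (p := i)
      (by have := Finset.mem_range.1 hi; omega)
    calc _ = (c i * δ ^ i) * ∑ k ∈ S, ∑ l ∈ S, a k * a l * ((k : ℝ) - l) ^ i := by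
          simp_rw [Finset.mul_sum]
          refine Finset.sum_congr rfl fun k _ => Finset.sum_congr rfl fun l _ => ?_
          rw [mul_pow]
          ring
      _ = 0 := by rw [this, mul_zero]
  rw [← sub_zero (∑ k ∈ S, ∑ l ∈ S, a k * a l * V (((k : ℝ) - l) * δ)), ← hpoly]
  simp only [Finset.mul_sum, Finset.sum_mul, ← Finset.sum_sub_distrib]
  refine Finset.sum_congr rfl fun k _ => Finset.sum_congr rfl fun l _ => ?_
  simp only [he]
  rw [abs_mul, Real.mul_rpow (abs_nonneg _) (abs_nonneg _), ← Finset.mul_sum]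
  ring

/-- under (H0), (H1), with `δ_n = n^{−α}` and a variation sequence `a` of
length `L` and order `M > D`: (i) `(−1)^D R(0,1,2D,|·|^s,a^{2*}) > 0`; (ii) the expectation
`E_n = −n' Σ_j (a^{2*})_j V(jδ_n)` of the quadratic `a`-variation satisfies
`E_n / (n C (−1)^D δ_n^{2D+s} R(0,1,2D,|·|^s,a^{2*})) → 1`. -/
theorem stmt_6 (V r : ℝ → ℝ) (D : ℕ) (C s α : ℝ)
    (hC : 0 < C) (hs0 : 0 < s) (hs2 : s < 2) (hα0 : 0 < α) (hα1 : α ≤ 1)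
    -- (H0)
    (hEven : ∀ h : ℝ, V (-h) = V h) (hSmooth : ContDiffOn ℝ (⊤ : ℕ∞) V (Set.Ioi 0))
    -- (H1)
    (hV2D : ContDiff ℝ ((2 * D : ℕ) : ℕ∞) V)
    (hExp : ∀ h : ℝ, iteratedDeriv (2 * D) V h
      = iteratedDeriv (2 * D) V 0 + C * (-1 : ℝ) ^ D * |h| ^ s + r h)
    (hro : r =o[nhds (0:ℝ)] fun h => |h| ^ s)
    -- variation sequence of length L and order M
    (a : ℤ → ℝ) (L M : ℕ) (hL : 1 ≤ L) (hM : 1 ≤ M)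
    (hsupp : ∀ j : ℤ, a j ≠ 0 → 0 ≤ j ∧ j ≤ (L : ℤ) - 1)
    (ha0 : a 0 ≠ 0) (haL : a ((L : ℤ) - 1) ≠ 0)
    (hmom : ∀ k : ℕ, k < M → ∑ᶠ j : ℤ, a j * (j : ℝ) ^ k = 0)
    (hmomM : ∑ᶠ j : ℤ, a j * (j : ℝ) ^ M ≠ 0)
    (hMD : D < M) :
    0 < (-1 : ℝ) ^ D * Rq 0 1 (2 * D) (fun x => |x| ^ s) (seqConv a a)
    ∧
    Tendsto (fun n : ℕ =>
        (-((n - L + 1 : ℕ) : ℝ) * ∑ᶠ j : ℤ, seqConv a a j * V (j * (n : ℝ) ^ (-α)))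
        / ((n : ℝ) * C * (-1 : ℝ) ^ D * ((n : ℝ) ^ (-α)) ^ (2 * (D : ℝ) + s)
            * Rq 0 1 (2 * D) (fun x => |x| ^ s) (seqConv a a)))
      atTop (nhds 1) := by
  set S : Finset ℤ := Finset.Icc 0 ((L : ℤ) - 1)
  set β := 2 * (D : ℝ) + s with hβ
  have haS (j : ℤ) (hj : j ∉ S) : a j = 0 := by
    by_contra h
    exact hj (Finset.mem_Icc.2 (hsupp j h))
  have hmomS (k : ℕ) (hk : k < M) : ∑ j ∈ S, a j * (j : ℝ) ^ k = 0 := by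
    rw [← hmom k hk, finsum_eq_sum_of_support_subset]
    intro j hj
    by_contra h
    exact hj (by simp [haS j h])
  have hquad (f : ℝ → ℝ) : ∑ᶠ j : ℤ, seqConv a a j * f j
      = ∑ k ∈ S, ∑ l ∈ S, a k * a l * f ((k : ℝ) - l) := by
    simpa using finsum_seqConv_mul S a haS fun j => f j
  set T := ∑ k ∈ S, ∑ l ∈ S, a k * a l * |(k : ℝ) - l| ^ β with hT
  have hR : Rq 0 1 (2 * D) (fun x => |x| ^ s) (seqConv a a) = -(taylorConst D s * T) := by
    rw [Rq_abs_rpow D hs0, hquad fun x => |x| ^ β]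
  have hK := taylorConst_pos D hs0
  have hTpos : 0 < (-1) ^ (D + 1) * T := by
    refine sum_sum_mul_abs_sub_rpow_pos S a ⟨0, ?_, ha0⟩ hmomS hMD hs0 hs2
    exact Finset.mem_Icc.2 (hsupp 0 ha0)
  have hT0 : T ≠ 0 := by
    rintro h
    simp [h] at hTpos
  refine ⟨?_, ?_⟩
  · rw [hR]
    have := mul_pos hK hTpos
    rw [pow_succ] at this
    linarith
  obtain ⟨c, hc⟩ := exists_taylor_isLittleO_abs_rpow hs0 hV2D hExp hro
  have hasymp := sum_sum_mul_isLittleO hc S a hmomS hMD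
  rw [← hβ, ← hT] at hasymp
  have hδ : Tendsto (fun n : ℕ => (n : ℝ) ^ (-α)) atTop (nhds 0) :=
    (tendsto_rpow_neg_atTop hα0).comp tendsto_natCast_atTop_atTop
  set B := C * (-1 : ℝ) ^ D * taylorConst D s with hB
  have hB0 : B ≠ 0 := by
    have : ((-1 : ℝ) ^ D) ≠ 0 := by simp
    positivity
  have hratio : Tendsto (fun n : ℕ => ((n - L + 1 : ℕ) : ℝ) / n) atTop (nhds 1) := by
    have h := (tendsto_const_div_atTop_nhds_zero_nat ((L : ℝ) - 1)).const_sub 1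
    rw [sub_zero] at h
    refine h.congr' ?_
    filter_upwards [eventually_ge_atTop L] with n hn
    have hn0 : (n : ℝ) ≠ 0 := by
      have : n ≠ 0 := by omega
      exact_mod_cast this
    push_cast [Nat.cast_sub hn]
    field_simp
    ring
  have herr := (((hasymp.comp_tendsto hδ).tendsto_div_nhds_zero).div_const (B * T)).const_add 1
  have hlim := hratio.mul herr
  simp only [zero_div, add_zero, mul_one] at hlim
  refine hlim.congr' ?_
  filter_upwards [eventually_gt_atTop 0] with n hn
  have hn0 : (0 : ℝ) < n := by exact_mod_cast hn
  have hδn : 0 < (n : ℝ) ^ (-α) := Real.rpow_pos_of_pos hn0 _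
  have hδβ : 0 < ((n : ℝ) ^ (-α)) ^ β := Real.rpow_pos_of_pos hδn _
  rw [hR, hquad fun x => V (x * (n : ℝ) ^ (-α))]
  simp only [Function.comp_apply, abs_of_pos hδn]
  rw [show (n : ℝ) * C * (-1) ^ D * ((n : ℝ) ^ (-α)) ^ β * -(taylorConst D s * T)
    = -(n * (B * T) * ((n : ℝ) ^ (-α)) ^ β) by rw [hB]; ring]
  generalize ∑ k ∈ S, ∑ l ∈ S, a k * a l * V (((k : ℝ) - l) * (n : ℝ) ^ (-α)) = W
  field_simp
  ring
end

section
/- Assume (H0), (H1) and (H2) hold for V with parameters D, C, s, let δ_n = n^{−α} with 0 < α ≤ 1, and let a be a variation sequence of length L and order M with M > D + s/2 + 1/4; set n' = n − L + 1. Then the series Σ_{i∈ℤ} R(i,1,2D,|·|^s,a^{2*})² is finite and positive, and the quantity W_n := 2 Σ_{i=−n'+1}^{n'−1} (n'−|i|) ( Σ_j (a^{2*})_j V((i+j)δ_n) )², which equals the variance Var(V_{a,n}) of the quadratic a-variation of a centered Gaussian process with semi-variogram V, satisfies W_n / ( 2 n C² δ_n^{4D+2s} Σ_{i∈ℤ}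 R(i,1,2D,|·|^s,a^{2*})² ) → 1 as n → ∞. -/
open Filter MeasureTheory

open scoped Nat

/-- The weighted average of `g` over `[0, 1]` appearing in the integral form of the Taylor remainder
of order `q`; for `q = 0` it is the evaluation at `1`. -/
noncomputable def taylorWeight (q : ℕ) (g : ℝ → ℝ) : ℝ :=
  if q = 0 then g 1
  else ∫ η in (0:ℝ)..1, ((1 - η) ^ (q - 1) / (Nat.factorial (q - 1) : ℝ)) * g η

theorem Rq_eq_taylorWeight (i : ℤ) (δ : ℝ) (q : ℕ) (f : ℝ → ℝ) (c : ℤ → ℝ) :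
    Rq i δ q f c = -∑ᶠ j : ℤ, c j * (j : ℝ) ^ q * taylorWeight q fun η => f ((i + j * η) * δ) := by
  unfold Rq taylorWeight
  split_ifs with h
  · simp [h]
  · rfl

theorem taylorWeight_intervalIntegrable (q : ℕ) {g : ℝ → ℝ} (hg : ContinuousOn g (Set.Icc 0 1)) :
    IntervalIntegrable (fun η => ((1 - η) ^ (q - 1) / (Nat.factorial (q - 1) : ℝ)) * g η)
      volume 0 1 := by
  apply ContinuousOn.intervalIntegrable
  rw [Set.uIcc_of_le zero_le_one]
  exact (by fun_prop : Continuous fun η : ℝ =>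
    (1 - η) ^ (q - 1) / (Nat.factorial (q - 1) : ℝ)).continuousOn.mul hg

theorem taylorWeight_add (q : ℕ) {f g : ℝ → ℝ} (hf : ContinuousOn f (Set.Icc 0 1))
    (hg : ContinuousOn g (Set.Icc 0 1)) :
    taylorWeight q (fun η => f η + g η) = taylorWeight q f + taylorWeight q g := by
  unfold taylorWeight
  split_ifs with h
  · rfl
  · rw [← intervalIntegral.integral_add (taylorWeight_intervalIntegrable q hf)
      (taylorWeight_intervalIntegrable q hg)]
    simp only [mul_add]

theorem taylorWeight_const_mul (q : ℕ) (b : ℝ) (g : ℝ → ℝ) :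
    taylorWeight q (fun η => b * g η) = b * taylorWeight q g := by
  unfold taylorWeight
  split_ifs with h
  · rfl
  · rw [← intervalIntegral.integral_const_mul]
    congr 1
    ext η
    ring

theorem taylorWeight_sum {ι : Type*} (q : ℕ) (t : Finset ι) (g : ι → ℝ → ℝ)
    (hg : ∀ k ∈ t, ContinuousOn (g k) (Set.Icc 0 1)) :
    taylorWeight q (fun η => ∑ k ∈ t, g k η) = ∑ k ∈ t, taylorWeight q (g k) := by
  unfold taylorWeight
  split_ifs with h
  · rfl
  · rw [← intervalIntegral.integral_finsetSum
      fun k hk => taylorWeight_intervalIntegrable q (hg k hk)]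
    simp only [Finset.mul_sum]

theorem taylorWeight_congr (q : ℕ) {f g : ℝ → ℝ} (h : Set.EqOn f g (Set.Icc 0 1)) :
    taylorWeight q f = taylorWeight q g := by
  unfold taylorWeight
  split_ifs with hq
  · exact h (by simp)
  · apply intervalIntegral.integral_congr
    intro η hη
    rw [Set.uIcc_of_le zero_le_one] at hη
    simp only [h hη]

theorem abs_taylorWeight_le (q : ℕ) {g : ℝ → ℝ} {B : ℝ} (hB : ∀ η ∈ Set.Icc (0:ℝ) 1, |g η| ≤ B) :
    |taylorWeight q g| ≤ B := by
  have hB0 : 0 ≤ B := (abs_nonneg _).trans (hB 0 (by simp))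
  unfold taylorWeight
  split_ifs with h
  · exact hB 1 (by simp)
  · have := intervalIntegral.norm_integral_le_of_norm_le_const (a := 0) (b := 1) (C := B)
      (f := fun η : ℝ => ((1 - η) ^ (q - 1) / (Nat.factorial (q - 1) : ℝ)) * g η) ?_
    · simpa using this
    · intro η hη
      rw [Set.uIoc_of_le zero_le_one] at hη
      rw [norm_mul, Real.norm_eq_abs, Real.norm_eq_abs]
      have h1 : |(1 - η) ^ (q - 1) / (Nat.factorial (q - 1) : ℝ)| ≤ 1 := by
        have h2 : 0 ≤ 1 - η := by linarith [hη.2]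
        rw [abs_of_nonneg (by positivity), div_le_one (by positivity)]
        calc (1 - η) ^ (q - 1) ≤ 1 := pow_le_one₀ h2 (by linarith [hη.1])
          _ ≤ _ := by exact_mod_cast Nat.one_le_iff_ne_zero.mpr (Nat.factorial_ne_zero _)
      calc _ ≤ 1 * B := mul_le_mul h1 (hB η ⟨hη.1.le, hη.2⟩) (abs_nonneg _) zero_le_one
        _ = B := one_mul B

theorem taylorWeight_pos (q : ℕ) {g : ℝ → ℝ} (hg : ContinuousOn g (Set.Icc 0 1))
    (h0 : ∀ η ∈ Set.Icc (0:ℝ) 1, 0 ≤ g η) (h1 : 0 < g 1) : 0 < taylorWeight q g := by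
  unfold taylorWeight
  split_ifs with h
  · exact h1
  · have hcont : ContinuousOn (fun η => ((1 - η) ^ (q - 1) / (Nat.factorial (q - 1) : ℝ)) * g η)
        (Set.Icc 0 1) :=
      (by fun_prop : Continuous fun η : ℝ =>
        (1 - η) ^ (q - 1) / (Nat.factorial (q - 1) : ℝ)).continuousOn.mul hg
    apply intervalIntegral.integral_pos zero_lt_one hcont
    · intro η hη
      have : 0 ≤ 1 - η := by linarith [hη.2]
      exact mul_nonneg (by positivity) (h0 η ⟨hη.1.le, hη.2⟩)
    · have h2 : ∀ᶠ η in nhdsWithin (1:ℝ) (Set.Icc 0 1), 0 < g η :=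
        (hg 1 (by simp)).eventually (lt_mem_nhds h1)
      have h3 : ∀ᶠ η in nhdsWithin (1:ℝ) (Set.Iio 1), 0 < g η ∧ η ∈ Set.Ioo (0:ℝ) 1 := by
        have h4 : Set.Ioo (0:ℝ) 1 ∈ nhdsWithin (1:ℝ) (Set.Iio 1) := Ioo_mem_nhdsLT zero_lt_one
        have h5 : nhdsWithin (1:ℝ) (Set.Iio 1) ≤ nhdsWithin (1:ℝ) (Set.Icc 0 1) := by
          rw [← nhdsWithin_Ioo_eq_nhdsLT zero_lt_one]
          exact nhdsWithin_mono _ Set.Ioo_subset_Icc_self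
        exact Filter.Eventually.and (h5 h2) h4
      obtain ⟨η, hη, hη'⟩ := h3.exists
      have : 0 < 1 - η := by linarith [hη'.2]
      exact ⟨η, Set.Ioo_subset_Icc_self hη', by positivity⟩

/-- Taylor's formula at `x` with increment `y`, the remainder being bounded through the derivative
of order `Q`. -/
theorem abs_sub_taylor_sum_le {f : ℝ → ℝ} {U : Set ℝ} (hU : IsOpen U) {Q : ℕ}
    (hf : ContDiffOn ℝ Q f U) {x y B : ℝ} (hxy : Set.uIcc x (x + y) ⊆ U)
    (hB : ∀ z ∈ Set.uIcc x (x + y), |iteratedDeriv Q f z| ≤ B) :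
    |f (x + y) - ∑ k ∈ Finset.range Q, iteratedDeriv k f x / k ! * y ^ k| ≤ B * |y| ^ Q := by
  have hB0 : 0 ≤ B := (abs_nonneg _).trans (hB x Set.left_mem_uIcc)
  have hxU : x ∈ U := hxy Set.left_mem_uIcc
  rcases Q with _ | n
  · simpa using hB (x + y) Set.right_mem_uIcc
  rcases eq_or_ne y 0 with rfl | hy
  · simp [Finset.sum_range_succ']
  have hne : x ≠ x + y := by simpa using hy
  obtain ⟨z, hz, hz'⟩ := taylor_mean_remainder_lagrange_iteratedDeriv (n := n) hne
    (by exact_mod_cast hf.mono hxy)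
  have hsum : taylorWithinEval f n (Set.uIcc x (x + y)) x (x + y)
      = ∑ k ∈ Finset.range (n + 1), iteratedDeriv k f x / k ! * y ^ k := by
    rw [taylor_within_apply]
    refine Finset.sum_congr rfl fun k hk => ?_
    have hk' : k ≤ n + 1 := (Finset.mem_range.mp hk).le
    rw [iteratedDerivWithin_eq_iteratedDeriv (uniqueDiffOn_uIcc hne)
      ((hf.contDiffAt (hU.mem_nhds hxU)).of_le (by exact_mod_cast hk')) Set.left_mem_uIcc]
    simp only [add_sub_cancel_left, smul_eq_mul]
    ring
  rw [← hsum, hz', add_sub_cancel_left, abs_div, abs_mul, abs_pow, Nat.abs_cast]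
  have h1 : (1:ℝ) ≤ ((n + 1)! : ℕ) := by
    exact_mod_cast Nat.one_le_iff_ne_zero.mpr (Nat.factorial_ne_zero _)
  calc |iteratedDeriv (n + 1) f z| * |y| ^ (n + 1) / ((n + 1)! : ℕ)
      ≤ |iteratedDeriv (n + 1) f z| * |y| ^ (n + 1) := div_le_self (by positivity) h1
    _ ≤ B * |y| ^ (n + 1) := by
      gcongr
      exact hB z (Set.uIoo_subset_uIcc_self hz)

/-- Taylor's formula of order `q` with the remainder as a weighted average of the derivative. -/
theorem eq_taylor_sum_add_taylorWeight {f : ℝ → ℝ} {q : ℕ} (hf : ContDiff ℝ q f) (x y : ℝ) :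
    f (x + y) = ∑ k ∈ Finset.range q, iteratedDeriv k f x / k ! * y ^ k
      + y ^ q * taylorWeight q fun η => iteratedDeriv q f (x + y * η) := by
  rcases q with _ | n
  · simp [taylorWeight]
  rcases eq_or_ne y 0 with rfl | hy
  · simp [Finset.sum_range_succ']
  have hne : x ≠ x + y := by simpa using hy
  have h := taylor_integral_remainder (f := f) (x := x + y) (x₀ := x) (n := n) hf.contDiffOn
  have hsum : taylorWithinEval f n (Set.uIcc x (x + y)) x (x + y)
      = ∑ k ∈ Finset.range (n + 1), iteratedDeriv k f x / k ! * y ^ k := by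
    rw [taylor_within_apply]
    refine Finset.sum_congr rfl fun k hk => ?_
    have hk' : k ≤ n + 1 := (Finset.mem_range.mp hk).le
    rw [iteratedDerivWithin_eq_iteratedDeriv (uniqueDiffOn_uIcc hne)
      (hf.contDiffAt.of_le (by exact_mod_cast hk')) Set.left_mem_uIcc]
    simp only [add_sub_cancel_left, smul_eq_mul]
    ring
  rw [← hsum, ← sub_eq_iff_eq_add', h]
  have h2 : (∫ t in x..x + y, ((x + y - t) ^ n / n !) •
      iteratedDerivWithin (n + 1) f (Set.uIcc x (x + y)) t)
      = ∫ t in x..x + y, ((x + y - t) ^ n / n !) * iteratedDeriv (n + 1) f t := by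
    apply intervalIntegral.integral_congr
    intro t ht
    simp only [smul_eq_mul]
    rw [iteratedDerivWithin_eq_iteratedDeriv (uniqueDiffOn_uIcc hne) hf.contDiffAt ht]
  have h3 := intervalIntegral.smul_integral_comp_add_mul (a := 0) (b := 1)
    (fun t => ((x + y - t) ^ n / n !) * iteratedDeriv (n + 1) f t) y x
  simp only [mul_zero, add_zero, mul_one, smul_eq_mul] at h3
  rw [h2, ← h3, taylorWeight, if_neg (Nat.succ_ne_zero n), pow_succ', mul_assoc,
    ← intervalIntegral.integral_const_mul (y ^ n)]
  congr 2
  ext η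
  rw [add_sub_add_left_eq_sub, ← mul_one_sub, mul_pow, Nat.add_sub_cancel]
  ring

theorem finsum_eq_sum_Icc {c : ℤ → ℝ} {L : ℕ}
    (hc : ∀ j, c j ≠ 0 → j ∈ Finset.Icc (-(L:ℤ)) L) (g : ℤ → ℝ) :
    ∑ᶠ j, c j * g j = ∑ j ∈ Finset.Icc (-(L:ℤ)) L, c j * g j := by
  apply finsum_eq_sum_of_support_subset
  intro j hj
  exact_mod_cast hc j (left_ne_zero_of_mul hj)

theorem Rq_eq_sum {c : ℤ → ℝ} {L : ℕ} (hc : ∀ j, c j ≠ 0 → j ∈ Finset.Icc (-(L:ℤ)) L)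
    (i : ℤ) (δ : ℝ) (q : ℕ) (f : ℝ → ℝ) :
    Rq i δ q f c = -∑ j ∈ Finset.Icc (-(L:ℤ)) L,
      c j * ((j : ℝ) ^ q * taylorWeight q fun η => f ((i + j * η) * δ)) := by
  rw [Rq_eq_taylorWeight, ← finsum_eq_sum_Icc hc]
  simp only [mul_assoc]

/-- Taylor expansion of order `Q` of `f` inside `Rq`, around the point `i * δ`. -/
theorem abs_Rq_add_le {c : ℤ → ℝ} {L : ℕ} (hc : ∀ j, c j ≠ 0 → j ∈ Finset.Icc (-(L:ℤ)) L)
    {f : ℝ → ℝ} {U : Set ℝ} (hU : IsOpen U) {Q : ℕ} (hf : ContDiffOn ℝ Q f U) (i : ℤ) (δ : ℝ)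
    (q : ℕ) {B : ℝ} (hiU : ∀ y : ℝ, |y| ≤ L → (i + y) * δ ∈ U)
    (hB : ∀ y : ℝ, |y| ≤ L → |iteratedDeriv Q f ((i + y) * δ)| ≤ B) :
    |Rq i δ q f c + ∑ k ∈ Finset.range Q, iteratedDeriv k f (i * δ) / k ! * δ ^ k *
        taylorWeight q (fun η => η ^ k) * ∑ j ∈ Finset.Icc (-(L:ℤ)) L, c j * (j : ℝ) ^ (q + k)|
      ≤ B * |δ| ^ Q * ∑ j ∈ Finset.Icc (-(L:ℤ)) L, |c j| * |(j : ℝ)| ^ (q + Q) := by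
  set E : ℤ → ℝ → ℝ := fun j η => f ((i + j * η) * δ)
    - ∑ k ∈ Finset.range Q, iteratedDeriv k f (i * δ) / k ! * (j * η * δ) ^ k with hE
  have hjη : ∀ j ∈ Finset.Icc (-(L:ℤ)) L, ∀ η ∈ Set.Icc (0:ℝ) 1, |(j:ℝ) * η| ≤ L := by
    intro j hj η hη
    rw [Finset.mem_Icc] at hj
    have h1 : |(j:ℝ)| ≤ L := abs_le.mpr ⟨by exact_mod_cast hj.1, by exact_mod_cast hj.2⟩
    rw [abs_mul, abs_of_nonneg hη.1]
    calc |(j:ℝ)| * η ≤ L * 1 := mul_le_mul h1 hη.2 hη.1 (by positivity)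
      _ = L := mul_one _
  have hseg : ∀ j ∈ Finset.Icc (-(L:ℤ)) L, ∀ η ∈ Set.Icc (0:ℝ) 1,
      ∀ z ∈ Set.uIcc ((i:ℝ) * δ) (i * δ + j * η * δ), ∃ y : ℝ, |y| ≤ L ∧ z = (i + y) * δ := by
    intro j hj η hη z hz
    rw [← segment_eq_uIcc, segment_eq_image'] at hz
    obtain ⟨θ, hθ, rfl⟩ := hz
    refine ⟨j * (θ * η), hjη j hj _ ⟨mul_nonneg hθ.1 hη.1, ?_⟩, ?_⟩
    · exact mul_le_one₀ hθ.2 hη.1 hη.2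
    · simp only [add_sub_cancel_left, smul_eq_mul]
      ring
  have hEle : ∀ j ∈ Finset.Icc (-(L:ℤ)) L, ∀ η ∈ Set.Icc (0:ℝ) 1,
      |E j η| ≤ B * (|(j:ℝ)| * |δ|) ^ Q := by
    intro j hj η hη
    have h := abs_sub_taylor_sum_le hU hf (x := i * δ) (y := j * η * δ) (B := B)
      (fun z hz => by obtain ⟨y, hy, rfl⟩ := hseg j hj η hη z hz; exact hiU y hy)
      (fun z hz => by obtain ⟨y, hy, rfl⟩ := hseg j hj η hη z hz; exact hB y hy)
    have hB0 : 0 ≤ B := (abs_nonneg _).trans (hB 0 (by simp))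
    rw [← add_mul] at h
    refine h.trans ?_
    rw [abs_mul, abs_mul, abs_of_nonneg hη.1]
    have : |(j:ℝ)| * η ≤ |(j:ℝ)| := mul_le_of_le_one_right (abs_nonneg _) hη.2
    have h0 := hη.1
    gcongr
  have hfc : ∀ j ∈ Finset.Icc (-(L:ℤ)) L,
      ContinuousOn (fun η : ℝ => f ((i + j * η) * δ)) (Set.Icc 0 1) := by
    intro j hj
    refine hf.continuousOn.comp (by fun_prop) fun η hη => hiU _ (hjη j hj η hη)
  have hEc : ∀ j ∈ Finset.Icc (-(L:ℤ)) L, ContinuousOn (E j) (Set.Icc 0 1) := fun j hj =>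
    (hfc j hj).sub (by fun_prop)
  have hW : ∀ j ∈ Finset.Icc (-(L:ℤ)) L, taylorWeight q (fun η => f ((i + j * η) * δ))
      = ∑ k ∈ Finset.range Q, iteratedDeriv k f (i * δ) / k ! * δ ^ k * (j:ℝ) ^ k *
          taylorWeight q (fun η => η ^ k) + taylorWeight q (E j) := by
    intro j hj
    have h1 : (fun η : ℝ => f ((i + j * η) * δ)) = fun η => (∑ k ∈ Finset.range Q,
        (iteratedDeriv k f (i * δ) / k ! * δ ^ k * (j:ℝ) ^ k) * η ^ k) + E j η := by
      ext η
      simp only [hE, mul_pow]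
      rw [← sub_eq_iff_eq_add', sub_right_inj]
      exact Finset.sum_congr rfl fun k _ => by ring
    rw [h1, taylorWeight_add q (by fun_prop) (hEc j hj), taylorWeight_sum q _ _ (by fun_prop)]
    simp only [taylorWeight_const_mul]
  have hmain : Rq i δ q f c + ∑ k ∈ Finset.range Q, iteratedDeriv k f (i * δ) / k ! * δ ^ k *
        taylorWeight q (fun η => η ^ k) * ∑ j ∈ Finset.Icc (-(L:ℤ)) L, c j * (j : ℝ) ^ (q + k)
      = -∑ j ∈ Finset.Icc (-(L:ℤ)) L, c j * ((j:ℝ) ^ q * taylorWeight q (E j)) := by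
    rw [Rq_eq_sum hc, Finset.sum_congr rfl fun j hj => by rw [hW j hj]]
    simp only [mul_add, Finset.sum_add_distrib, Finset.mul_sum]
    rw [Finset.sum_comm, neg_add, add_right_comm, add_eq_right, neg_add_eq_zero]
    refine Finset.sum_congr rfl fun k _ => Finset.sum_congr rfl fun j _ => ?_
    rw [pow_add]
    ring
  rw [hmain, abs_neg]
  refine (Finset.abs_sum_le_sum_abs _ _).trans ?_
  rw [Finset.mul_sum]
  refine Finset.sum_le_sum fun j hj => ?_
  rw [abs_mul, abs_mul, abs_pow]
  calc |c j| * (|(j:ℝ)| ^ q * |taylorWeight q (E j)|)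
      ≤ |c j| * (|(j:ℝ)| ^ q * (B * (|(j:ℝ)| * |δ|) ^ Q)) := by
        gcongr
        exact abs_taylorWeight_le q (hEle j hj)
    _ = _ := by rw [pow_add, mul_pow]; ring

theorem mem_Icc_of_seqConv_ne_zero {a : ℤ → ℝ} {L : ℕ}
    (hsupp : ∀ j : ℤ, a j ≠ 0 → 0 ≤ j ∧ j ≤ (L : ℤ) - 1) (j : ℤ) (hj : seqConv a a j ≠ 0) :
    -((L:ℤ) - 1) ≤ j ∧ j ≤ (L:ℤ) - 1 := by
  obtain ⟨k, hk⟩ : ∃ k, a k * a (k - j) ≠ 0 := by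
    by_contra! h
    exact hj (finsum_eq_zero_of_forall_eq_zero h)
  have h1 := hsupp k (left_ne_zero_of_mul hk)
  have h2 := hsupp (k - j) (right_ne_zero_of_mul hk)
  omega

theorem seqConv_self_last {a : ℤ → ℝ} {L : ℕ}
    (hsupp : ∀ j : ℤ, a j ≠ 0 → 0 ≤ j ∧ j ≤ (L : ℤ) - 1) :
    seqConv a a ((L:ℤ) - 1) = a ((L:ℤ) - 1) * a 0 := by
  unfold seqConv
  rw [finsum_eq_single _ ((L:ℤ) - 1), sub_self]
  intro k hk
  by_contra h
  have h1 := hsupp k (left_ne_zero_of_mul h)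
  have h2 := hsupp (k - (L - 1)) (right_ne_zero_of_mul h)
  omega

theorem sum_seqConv_mul {a : ℤ → ℝ} {L : ℕ}
    (hsupp : ∀ j : ℤ, a j ≠ 0 → 0 ≤ j ∧ j ≤ (L : ℤ) - 1) (g : ℤ → ℝ) :
    ∑ j ∈ Finset.Icc (-(L:ℤ)) L, seqConv a a j * g j
      = ∑ k ∈ Finset.Icc (-(L:ℤ)) L, ∑ l ∈ Finset.Icc (-(L:ℤ)) L, a k * a l * g (k - l) := by
  have hS : ∀ j, a j ≠ 0 → j ∈ Finset.Icc (-(L:ℤ)) L := fun j hj => by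
    have := hsupp j hj
    rw [Finset.mem_Icc]
    omega
  have hconv : ∀ j, seqConv a a j = ∑ k ∈ Finset.Icc (-(L:ℤ)) L, a k * a (k - j) := fun j =>
    finsum_eq_sum_Icc hS fun k => a (k - j)
  simp only [hconv, Finset.sum_mul]
  rw [Finset.sum_comm]
  refine Finset.sum_congr rfl fun k _ => ?_
  by_cases hk : a k = 0
  · simp [hk]
  have hk' := hsupp k hk
  have h1 : ∑ᶠ j, a (k - j) * g j = ∑ᶠ l, a l * g (k - l) := by
    rw [← finsum_comp_equiv (Equiv.subLeft k)]
    simp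
  rw [finsum_eq_sum_Icc hS, finsum_eq_sum_Icc (c := fun j => a (k - j)) (L := L)] at h1
  · simp only [mul_assoc, ← Finset.mul_sum, h1]
  · intro j hj
    have := hsupp _ hj
    rw [Finset.mem_Icc]
    omega

theorem sum_seqConv_mul_pow {a : ℤ → ℝ} {L : ℕ}
    (hsupp : ∀ j : ℤ, a j ≠ 0 → 0 ≤ j ∧ j ≤ (L : ℤ) - 1) (n : ℕ) :
    ∑ j ∈ Finset.Icc (-(L:ℤ)) L, seqConv a a j * (j:ℝ) ^ n
      = ∑ m ∈ Finset.range (n + 1), (n.choose m : ℝ) * (-1) ^ (n - m) *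
          (∑ᶠ j : ℤ, a j * (j:ℝ) ^ m) * ∑ᶠ j : ℤ, a j * (j:ℝ) ^ (n - m) := by
  have hS : ∀ j, a j ≠ 0 → j ∈ Finset.Icc (-(L:ℤ)) L := fun j hj => by
    have := hsupp j hj
    rw [Finset.mem_Icc]
    omega
  rw [sum_seqConv_mul hsupp fun j => (j:ℝ) ^ n]
  have hpow : ∀ k l : ℤ, ((k - l : ℤ) : ℝ) ^ n = ∑ m ∈ Finset.range (n + 1),
      (k:ℝ) ^ m * (-(l:ℝ)) ^ (n - m) * (n.choose m : ℝ) := fun k l => by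
    rw [Int.cast_sub, sub_eq_add_neg, add_pow]
  simp only [finsum_eq_sum_Icc hS, hpow, Finset.mul_sum, Finset.sum_mul]
  refine (Finset.sum_congr rfl fun k _ => Finset.sum_comm).trans ?_
  rw [Finset.sum_comm]
  refine Finset.sum_congr rfl fun m _ => ?_
  rw [Finset.sum_comm]
  refine Finset.sum_congr rfl fun l _ => Finset.sum_congr rfl fun k _ => ?_
  rw [neg_pow]
  ring

theorem sum_seqConv_mul_pow_eq_zero {a : ℤ → ℝ} {L M : ℕ}
    (hsupp : ∀ j : ℤ, a j ≠ 0 → 0 ≤ j ∧ j ≤ (L : ℤ) - 1)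
    (hmom : ∀ k : ℕ, k < M → ∑ᶠ j : ℤ, a j * (j : ℝ) ^ k = 0) {n : ℕ} (hn : n < 2 * M) :
    ∑ j ∈ Finset.Icc (-(L:ℤ)) L, seqConv a a j * (j:ℝ) ^ n = 0 := by
  rw [sum_seqConv_mul_pow hsupp]
  refine Finset.sum_eq_zero fun m _ => ?_
  rcases lt_or_ge m M with h | h
  · rw [hmom m h]
    ring
  · rw [hmom (n - m) (by omega)]
    ring

theorem sum_seqConv_mul_pow_ne_zero {a : ℤ → ℝ} {L M : ℕ}
    (hsupp : ∀ j : ℤ, a j ≠ 0 → 0 ≤ j ∧ j ≤ (L : ℤ) - 1)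
    (hmom : ∀ k : ℕ, k < M → ∑ᶠ j : ℤ, a j * (j : ℝ) ^ k = 0)
    (hmomM : ∑ᶠ j : ℤ, a j * (j : ℝ) ^ M ≠ 0) :
    ∑ j ∈ Finset.Icc (-(L:ℤ)) L, seqConv a a j * (j:ℝ) ^ (2 * M) ≠ 0 := by
  rw [sum_seqConv_mul_pow hsupp, Finset.sum_eq_single M]
  · have h : 2 * M - M = M := by omega
    have h2 : ((2 * M).choose M : ℝ) ≠ 0 := by
      exact_mod_cast (Nat.choose_pos (by omega : M ≤ 2 * M)).ne'
    rw [h]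
    exact mul_ne_zero (mul_ne_zero (mul_ne_zero h2 (by simp)) hmomM) hmomM
  · intro m hm hmM
    rw [Finset.mem_range] at hm
    rcases lt_or_ge m M with h | h
    · rw [hmom m h]
      ring
    · rw [hmom (2 * M - m) (by omega)]
      ring
  · intro h
    rw [Finset.mem_range] at h
    omega

theorem contDiffOn_abs_rpow (s : ℝ) (n : ℕ) :
    ContDiffOn ℝ n (fun x : ℝ => |x| ^ s) {(0:ℝ)}ᶜ := by
  intro x hx
  have hx' : x ≠ 0 := hx
  exact ((contDiffAt_abs hx').rpow_const_of_ne (abs_ne_zero.mpr hx')).contDiffWithinAt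

theorem iteratedDeriv_abs_rpow_of_pos (s : ℝ) (k : ℕ) {x : ℝ} (hx : 0 < x) :
    iteratedDeriv k (fun x : ℝ => |x| ^ s) x = (descPochhammer ℝ k).eval s * x ^ (s - k) := by
  have h : (fun x : ℝ => |x| ^ s) =ᶠ[nhds x] fun x => x ^ s := by
    filter_upwards [lt_mem_nhds hx] with y hy
    rw [abs_of_pos hy]
  rw [h.iteratedDeriv_eq, iteratedDeriv_eq_iterate, Real.iter_deriv_rpow_const]

theorem abs_iteratedDeriv_abs_rpow (s : ℝ) (k : ℕ) {x : ℝ} (hx : x ≠ 0) :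
    |iteratedDeriv k (fun x : ℝ => |x| ^ s) x|
      = |(descPochhammer ℝ k).eval s| * |x| ^ (s - k) := by
  rcases hx.lt_or_gt with h | h
  · have h1 := iteratedDeriv_comp_neg k (fun x : ℝ => |x| ^ s) x
    simp only [abs_neg] at h1
    rw [h1, iteratedDeriv_abs_rpow_of_pos s k (neg_pos.mpr h), abs_of_neg h]
    rw [smul_eq_mul, abs_mul, abs_mul, abs_pow, abs_neg, abs_one, one_pow, one_mul,
      abs_of_nonneg (Real.rpow_nonneg (neg_pos.mpr h).le _)]
  · rw [iteratedDeriv_abs_rpow_of_pos s k h, abs_of_pos h, abs_mul,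
      abs_of_nonneg (Real.rpow_nonneg h.le _)]

/-- If the moments of `c` of order `< q + Q` vanish and the `Q`-th derivative of `f` is at most
`K * |h| ^ β`, then `Rq i δ q f c` decays like `(|i| * δ) ^ β`. -/
theorem abs_Rq_le_of_moments_eq_zero {c : ℤ → ℝ} {L : ℕ}
    (hc : ∀ j, c j ≠ 0 → j ∈ Finset.Icc (-(L:ℤ)) L) {f : ℝ → ℝ} {q Q : ℕ}
    (hmom : ∀ n < q + Q, ∑ j ∈ Finset.Icc (-(L:ℤ)) L, c j * (j : ℝ) ^ n = 0)
    (hf : ContDiffOn ℝ Q f {(0:ℝ)}ᶜ) {K β : ℝ} (hK : 0 ≤ K) (hβ : β ≤ 0)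
    (hfK : ∀ h ≠ 0, |iteratedDeriv Q f h| ≤ K * |h| ^ β) :
    ∃ A, 0 ≤ A ∧ ∀ (i : ℤ) (δ : ℝ), 0 < δ → 2 * (L:ℝ) < |(i:ℝ)| →
      |Rq i δ q f c| ≤ A * |(i:ℝ)| ^ β * δ ^ (Q + β) := by
  refine ⟨K * (1 / 2) ^ β * ∑ j ∈ Finset.Icc (-(L:ℤ)) L, |c j| * |(j : ℝ)| ^ (q + Q),
    by positivity, fun i δ hδ hi => ?_⟩
  have hi0 : 0 < |(i:ℝ)| := lt_of_le_of_lt (by positivity) hi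
  have hy : ∀ y : ℝ, |y| ≤ L → 1 / 2 * |(i:ℝ)| ≤ |(i + y : ℝ)| := by
    intro y hy
    have h1 : |(i:ℝ)| - |y| ≤ |(i + y : ℝ)| := by
      have := abs_sub_abs_le_abs_sub (i:ℝ) (-y)
      rwa [abs_neg, sub_neg_eq_add] at this
    linarith
  have hne : ∀ y : ℝ, |y| ≤ L → (i + y) * δ ≠ 0 := fun y hyL =>
    mul_ne_zero (abs_pos.mp (by linarith [hy y hyL])) hδ.ne'
  have h := abs_Rq_add_le hc isOpen_compl_singleton hf i δ q
    (B := K * (1 / 2 * |(i:ℝ)| * δ) ^ β) hne (fun y hyL => by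
      refine (hfK _ (hne y hyL)).trans ?_
      rw [abs_mul, abs_of_pos hδ]
      refine mul_le_mul_of_nonneg_left ?_ hK
      refine Real.rpow_le_rpow_of_nonpos (by positivity) ?_ hβ
      exact mul_le_mul_of_nonneg_right (hy y hyL) hδ.le)
  rw [Finset.sum_eq_zero, add_zero] at h
  · refine h.trans_eq ?_
    rw [abs_of_pos hδ, Real.mul_rpow (by positivity) hδ.le, Real.mul_rpow (by positivity) hi0.le,
      Real.rpow_add hδ, Real.rpow_natCast]
    ring
  · intro k hk
    rw [hmom _ (by simpa using hk), mul_zero]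

theorem descPochhammer_eval_ne_zero {s : ℝ} (hs0 : 0 < s) (hs2 : s < 2) (hs1 : s ≠ 1) (k : ℕ) :
    (descPochhammer ℝ k).eval s ≠ 0 := by
  rw [descPochhammer_eval_eq_prod_range, Finset.prod_ne_zero_iff]
  intro j _ h
  have hj : s = j := sub_eq_zero.mp h
  have h1 : 0 < j := by exact_mod_cast hj ▸ hs0
  have h2 : j < 2 := by exact_mod_cast hj ▸ hs2
  have h3 : j = 1 := by omega
  exact hs1 (by rw [hj, h3, Nat.cast_one])

/-- For non-integer `s`, the leading term of the expansion of `Rq i 1 q |·|^s c` at infinity is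
given by the first non-vanishing moment of `c`. -/
theorem exists_Rq_abs_rpow_ne_zero {c : ℤ → ℝ} {L : ℕ}
    (hc : ∀ j, c j ≠ 0 → j ∈ Finset.Icc (-(L:ℤ)) L) {s : ℝ} (hs0 : 0 < s) (hs2 : s < 2)
    (hs1 : s ≠ 1) {q p : ℕ} (hp : 1 ≤ p)
    (hmom : ∀ n < q + p, ∑ j ∈ Finset.Icc (-(L:ℤ)) L, c j * (j : ℝ) ^ n = 0)
    (hmom' : ∑ j ∈ Finset.Icc (-(L:ℤ)) L, c j * (j : ℝ) ^ (q + p) ≠ 0) :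
    ∃ i : ℤ, Rq i 1 q (fun x => |x| ^ s) c ≠ 0 := by
  by_contra! hR
  set m := ∑ j ∈ Finset.Icc (-(L:ℤ)) L, c j * (j : ℝ) ^ (q + p) with hm
  set w := taylorWeight q (fun η => η ^ p) with hw
  have hw0 : 0 < w := taylorWeight_pos q (by fun_prop) (fun η hη => pow_nonneg hη.1 _) (by simp)
  set P := (descPochhammer ℝ p).eval s with hP
  have hP0 : P ≠ 0 := descPochhammer_eval_ne_zero hs0 hs2 hs1 p
  set κ := |P / p ! * w * m| with hκ
  have hκ0 : 0 < κ := abs_pos.mpr (mul_ne_zero (mul_ne_zero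
    (div_ne_zero hP0 (by exact_mod_cast Nat.factorial_ne_zero p)) hw0.ne') hmom')
  set A := |(descPochhammer ℝ (p + 1)).eval s| * (1 / 2) ^ (s - (p + 1)) *
    ∑ j ∈ Finset.Icc (-(L:ℤ)) L, |c j| * |(j : ℝ)| ^ (q + (p + 1)) with hA
  obtain ⟨N, hN⟩ := exists_nat_gt (max (2 * (L:ℝ)) (A / κ))
  have hN1 : 2 * (L:ℝ) < N := (le_max_left _ _).trans_lt hN
  have hN2 : A < N * κ := (div_lt_iff₀ hκ0).mp ((le_max_right _ _).trans_lt hN)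
  have hN0 : (0:ℝ) < N := lt_of_le_of_lt (by positivity) hN1
  have hp' : (1:ℝ) ≤ p := by exact_mod_cast hp
  have hy : ∀ y : ℝ, |y| ≤ L → 1 / 2 * (N:ℝ) ≤ (((N:ℤ):ℝ) + y) * 1 := by
    intro y hy
    have := (abs_le.mp hy).1
    push_cast
    linarith
  have h := abs_Rq_add_le hc isOpen_compl_singleton (contDiffOn_abs_rpow s (p + 1)) (N:ℤ) 1 q
    (B := |(descPochhammer ℝ (p + 1)).eval s| * (1 / 2 * N) ^ (s - (p + 1)))
    (fun y hyL => by
      have := hy y hyL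
      exact (by linarith : (0:ℝ) < _).ne')
    (fun y hyL => by
      have := hy y hyL
      rw [abs_iteratedDeriv_abs_rpow s _ (by linarith : (0:ℝ) < _).ne']
      refine mul_le_mul_of_nonneg_left ?_ (abs_nonneg _)
      push_cast
      refine Real.rpow_le_rpow_of_nonpos (by positivity) ?_ (by linarith)
      exact (hy y hyL).trans (le_abs_self _))
  rw [hR, zero_add, Finset.sum_range_succ, Finset.sum_eq_zero, zero_add, mul_one, Int.cast_natCast,
    iteratedDeriv_abs_rpow_of_pos s p hN0, ← hP, ← hw, ← hm, Real.mul_rpow (by positivity) hN0.le]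
    at h
  · have h1 : P * (N:ℝ) ^ (s - p) / p ! * 1 ^ p * w * m = P / p ! * w * m * (N:ℝ) ^ (s - p) := by
      rw [one_pow]
      ring
    rw [h1, abs_mul, ← hκ, abs_of_pos (Real.rpow_pos_of_pos hN0 _)] at h
    have h2 : (N:ℝ) ^ (s - p) = (N:ℝ) ^ (s - (p + 1)) * N := by
      rw [← Real.rpow_add_one hN0.ne']
      ring_nf
    have h3 : 0 < (N:ℝ) ^ (s - (p + 1)) := Real.rpow_pos_of_pos hN0 _
    have h4 : κ * (N:ℝ) ^ (s - p) ≤ A * (N:ℝ) ^ (s - (p + 1)) := by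
      refine h.trans_eq ?_
      rw [hA, abs_one, one_pow]
      ring
    rw [h2] at h4
    nlinarith
  · intro k hk
    rw [hmom _ (by simpa using hk), mul_zero]

/-- For `s = 1`, the extreme coefficient of `c` is detected at `i = 1 - m`. -/
theorem Rq_abs_one_sub_last_ne_zero {c : ℤ → ℝ} {L : ℕ}
    (hc : ∀ j, c j ≠ 0 → j ∈ Finset.Icc (-(L:ℤ)) L) {q : ℕ} {m : ℤ} (hm : 1 ≤ m) (hmL : m ≤ L)
    (hcm : ∀ j, c j ≠ 0 → j ≤ m) (hcm' : c m ≠ 0)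
    (hmom : ∑ j ∈ Finset.Icc (-(L:ℤ)) L, c j * (j : ℝ) ^ q = 0)
    (hmom' : ∑ j ∈ Finset.Icc (-(L:ℤ)) L, c j * (j : ℝ) ^ (q + 1) = 0) :
    Rq (1 - m) 1 q (fun x => |x|) c ≠ 0 := by
  set i : ℤ := 1 - m with hi
  have hW : ∀ j : ℤ, taylorWeight q (fun η => |((i:ℝ) + j * η) * 1|)
      = 2 * taylorWeight q (fun η => max ((i:ℝ) + j * η) 0) + ((-(i:ℝ)) * taylorWeight q (fun _ => 1)
        + (-(j:ℝ)) * taylorWeight q (fun η => η)) := by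
    intro j
    rw [← taylorWeight_const_mul, ← taylorWeight_const_mul, ← taylorWeight_const_mul,
      ← taylorWeight_add q (by fun_prop) (by fun_prop),
      ← taylorWeight_add q (by fun_prop) (by fun_prop)]
    congr 1
    ext η
    rcases le_total ((i:ℝ) + j * η) 0 with h | h
    · rw [mul_one, abs_of_nonpos h, max_eq_right h]
      ring
    · rw [mul_one, abs_of_nonneg h, max_eq_left h]
      ring
  have hmax : ∀ j : ℤ, j < m → taylorWeight q (fun η => max ((i:ℝ) + j * η) 0) = 0 := by
    intro j hj
    have h0 : taylorWeight q (fun _ => (0:ℝ)) = 0 := by simp [taylorWeight]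
    refine (taylorWeight_congr q fun η hη => max_eq_right ?_).trans h0
    have h1 : (j:ℝ) ≤ m - 1 := by exact_mod_cast Int.le_sub_one_of_lt hj
    have h2 : (1:ℝ) ≤ m := by exact_mod_cast hm
    have h3 : (j:ℝ) * η ≤ (m - 1) * η := mul_le_mul_of_nonneg_right h1 hη.1
    have h4 : ((m:ℝ) - 1) * η ≤ m - 1 := mul_le_of_le_one_right (by linarith) hη.2
    rw [hi]
    push_cast
    linarith
  have hpos : 0 < taylorWeight q (fun η => max ((i:ℝ) + m * η) 0) := by
    refine taylorWeight_pos q (by fun_prop) (fun η _ => le_max_right _ _) ?_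
    rw [hi]
    push_cast
    simp
  have hR : Rq i 1 q (fun x => |x|) c
      = -(c m * ((m:ℝ) ^ q * (2 * taylorWeight q (fun η => max ((i:ℝ) + m * η) 0)))) := by
    rw [Rq_eq_sum hc, neg_inj]
    simp only [hW, mul_add, Finset.sum_add_distrib]
    have h1 : ∑ j ∈ Finset.Icc (-(L:ℤ)) L,
        c j * ((j:ℝ) ^ q * (-(i:ℝ) * taylorWeight q (fun _ => 1))) = 0 := by
      have := congrArg (· * (-(i:ℝ) * taylorWeight q (fun _ => 1))) hmom
      simpa only [Finset.sum_mul, zero_mul, mul_assoc] using this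
    have h2 : ∑ j ∈ Finset.Icc (-(L:ℤ)) L,
        c j * ((j:ℝ) ^ q * (-(j:ℝ) * taylorWeight q (fun η => η))) = 0 := by
      have := congrArg (· * (-taylorWeight q (fun η => η))) hmom'
      simp only [Finset.sum_mul, zero_mul] at this
      rw [← this]
      exact Finset.sum_congr rfl fun j _ => by ring
    rw [h1, h2, add_zero, add_zero]
    refine Finset.sum_eq_single m ?_ ?_
    · intro j _ hj
      by_cases hj' : c j = 0
      · rw [hj', zero_mul]
      · rw [hmax j (lt_of_le_of_ne (hcm j hj') hj)]
        simp
    · intro h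
      rw [Finset.mem_Icc] at h
      omega
  have hm0 : (m:ℝ) ≠ 0 := by
    have : m ≠ 0 := by omega
    exact_mod_cast this
  rw [hR]
  exact neg_ne_zero.mpr (mul_ne_zero hcm' (mul_ne_zero (pow_ne_zero _ hm0)
    (mul_ne_zero two_ne_zero hpos.ne')))

/-- The kernel `Rq i 1 (2 * D) |·|^s` of the self-convolution of a variation sequence does not
vanish identically. -/
theorem exists_Rq_seqConv_ne_zero {a : ℤ → ℝ} {L M D : ℕ} {s : ℝ} (hs0 : 0 < s) (hs2 : s < 2)
    (hDM : D < M) (hsupp : ∀ j : ℤ, a j ≠ 0 → 0 ≤ j ∧ j ≤ (L : ℤ) - 1)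
    (ha0 : a 0 ≠ 0) (haL : a ((L : ℤ) - 1) ≠ 0)
    (hmom : ∀ k : ℕ, k < M → ∑ᶠ j : ℤ, a j * (j : ℝ) ^ k = 0)
    (hmomM : ∑ᶠ j : ℤ, a j * (j : ℝ) ^ M ≠ 0) :
    ∃ i : ℤ, Rq i 1 (2 * D) (fun x => |x| ^ s) (seqConv a a) ≠ 0 := by
  have hc : ∀ j, seqConv a a j ≠ 0 → j ∈ Finset.Icc (-(L:ℤ)) L := fun j hj => by
    have := mem_Icc_of_seqConv_ne_zero hsupp j hj
    rw [Finset.mem_Icc]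
    omega
  rcases ne_or_eq s 1 with hs1 | rfl
  · obtain ⟨p, hp⟩ : ∃ p, 2 * M = 2 * D + p := ⟨2 * M - 2 * D, by omega⟩
    refine exists_Rq_abs_rpow_ne_zero hc hs0 hs2 hs1 (p := p) (by omega) (fun n hn => ?_) ?_
    · exact sum_seqConv_mul_pow_eq_zero hsupp hmom (hp ▸ hn)
    · rw [← hp]
      exact sum_seqConv_mul_pow_ne_zero hsupp hmom hmomM
  · have h0 := hsupp 0 ha0
    have hL : (L:ℤ) ≠ 1 := by
      intro hL
      have h := hmom 0 (by omega)
      rw [finsum_eq_single _ 0] at h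
      · simp [ha0] at h
      · intro j hj
        by_contra h'
        have := hsupp j (left_ne_zero_of_mul h')
        omega
    refine ⟨1 - ((L:ℤ) - 1), ?_⟩
    simp only [Real.rpow_one]
    refine Rq_abs_one_sub_last_ne_zero hc (by omega) (by omega)
      (fun j hj => (mem_Icc_of_seqConv_ne_zero hsupp j hj).2) ?_
      (sum_seqConv_mul_pow_eq_zero hsupp hmom (by omega))
      (sum_seqConv_mul_pow_eq_zero hsupp hmom (by omega))
    rw [seqConv_self_last hsupp]
    exact mul_ne_zero haL ha0

/-- Decomposition of the filtered semi-variogram by Taylor's formula of order `q`. -/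
theorem finsum_mul_eq_Rq {c : ℤ → ℝ} {L : ℕ} (hc : ∀ j, c j ≠ 0 → j ∈ Finset.Icc (-(L:ℤ)) L)
    {V r : ℝ → ℝ} {q : ℕ} {b s v : ℝ} (hs : 0 < s) (hV : ContDiff ℝ q V)
    (hExp : ∀ h, iteratedDeriv q V h = v + b * |h| ^ s + r h)
    (hmom : ∀ n ≤ q, ∑ j ∈ Finset.Icc (-(L:ℤ)) L, c j * (j : ℝ) ^ n = 0)
    (i : ℤ) {δ : ℝ} (hδ : 0 < δ) :
    ∑ᶠ j : ℤ, c j * V ((i + j) * δ)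
      = -δ ^ q * (b * δ ^ s * Rq i 1 q (fun x => |x| ^ s) c + Rq i δ q r c) := by
  have hrc : Continuous r := by
    have h1 : r = fun h => iteratedDeriv q V h - (v + b * |h| ^ s) := by
      ext h
      rw [hExp]
      ring
    rw [h1]
    have h2 := hV.continuous_iteratedDeriv q le_rfl
    have h3 : Continuous fun h : ℝ => |h| ^ s := continuous_abs.rpow_const fun _ => Or.inr hs.le
    fun_prop
  have hsc : Continuous fun h : ℝ => |h| ^ s := continuous_abs.rpow_const fun _ => Or.inr hs.le
  have hW : ∀ j : ℤ, taylorWeight q (fun η => iteratedDeriv q V (i * δ + j * δ * η))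
      = v * taylorWeight q (fun _ => 1)
        + (b * δ ^ s * taylorWeight q (fun η => |((i:ℝ) + j * η) * 1| ^ s)
          + taylorWeight q (fun η => r ((i + j * η) * δ))) := by
    intro j
    have h1 : Continuous fun η : ℝ => b * δ ^ s * |((i:ℝ) + j * η) * 1| ^ s :=
      continuous_const.mul (hsc.comp (by fun_prop : Continuous fun η : ℝ => ((i:ℝ) + j * η) * 1))
    have h2 : Continuous fun η : ℝ => r ((i + j * η) * δ) := by fun_prop
    rw [← taylorWeight_const_mul, ← taylorWeight_const_mul,
      ← taylorWeight_add q h1.continuousOn h2.continuousOn,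
      ← taylorWeight_add q continuousOn_const (h1.fun_add h2).continuousOn]
    congr 1
    ext η
    rw [hExp, mul_one, (by ring : (i:ℝ) * δ + j * δ * η = (i + j * η) * δ), abs_mul,
      abs_of_pos hδ, Real.mul_rpow (abs_nonneg _) hδ.le]
    ring_nf
  have hT : ∀ j : ℤ, c j * V ((i + j) * δ) = (∑ k ∈ Finset.range q,
      iteratedDeriv k V (i * δ) / k ! * δ ^ k * (c j * (j:ℝ) ^ k))
      + (δ ^ q * v * taylorWeight q (fun _ => 1) * (c j * (j:ℝ) ^ q)
        + (δ ^ q * (b * δ ^ s) * (c j * ((j:ℝ) ^ q *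
            taylorWeight q (fun η => |((i:ℝ) + j * η) * 1| ^ s)))
          + δ ^ q * (c j * ((j:ℝ) ^ q * taylorWeight q (fun η => r ((i + j * η) * δ)))))) := by
    intro j
    rw [add_mul, eq_taylor_sum_add_taylorWeight hV, hW, mul_add, Finset.mul_sum]
    congr 1
    · exact Finset.sum_congr rfl fun k _ => by rw [mul_pow]; ring
    · rw [mul_pow]
      ring
  rw [finsum_eq_sum_Icc hc, Finset.sum_congr rfl fun j _ => hT j, Rq_eq_sum hc, Rq_eq_sum hc]
  simp only [Finset.sum_add_distrib, ← Finset.mul_sum]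
  rw [Finset.sum_comm, hmom q le_rfl, Finset.sum_eq_zero]
  · ring
  · intro k hk
    rw [← Finset.mul_sum, hmom k (Finset.mem_range.mp hk).le, mul_zero]

theorem tendsto_Rq_div_rpow {c : ℤ → ℝ} {L : ℕ}
    (hc : ∀ j, c j ≠ 0 → j ∈ Finset.Icc (-(L:ℤ)) L) {r : ℝ → ℝ} {s : ℝ} (hs : 0 < s)
    (hr : r =o[nhds (0:ℝ)] fun h => |h| ^ s) (i : ℤ) (q : ℕ) :
    Tendsto (fun δ => Rq i δ q r c / δ ^ s) (nhdsWithin 0 (Set.Ioi 0)) (nhds 0) := by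
  have hW : ∀ j : ℤ, Tendsto (fun δ => taylorWeight q (fun η => r ((i + j * η) * δ)) / δ ^ s)
      (nhdsWithin 0 (Set.Ioi 0)) (nhds 0) := by
    intro j
    rw [Metric.tendsto_nhds]
    intro ε hε
    set Y : ℝ := |(i:ℝ)| + |(j:ℝ)| + 1 with hY
    have hY0 : 0 < Y := by positivity
    have hYs : 0 < Y ^ s := Real.rpow_pos_of_pos hY0 s
    have h1 := hr.def (c := ε / (2 * Y ^ s)) (by positivity)
    obtain ⟨ρ, hρ, h2⟩ := Metric.eventually_nhds_iff.mp h1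
    filter_upwards [Ioo_mem_nhdsGT (by positivity : (0:ℝ) < ρ / Y)] with δ hδ
    have hδs : 0 < δ ^ s := Real.rpow_pos_of_pos hδ.1 s
    have h3 : |taylorWeight q (fun η => r ((i + j * η) * δ))| ≤ ε / 2 * δ ^ s := by
      refine abs_taylorWeight_le q fun η hη => ?_
      have h4 : |((i:ℝ) + j * η) * δ| ≤ Y * δ := by
        rw [abs_mul, abs_of_pos hδ.1]
        refine mul_le_mul_of_nonneg_right ?_ hδ.1.le
        refine (abs_add_le _ _).trans ?_
        rw [abs_mul, abs_of_nonneg hη.1]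
        have := mul_le_of_le_one_right (abs_nonneg (j:ℝ)) hη.2
        linarith
      have h5 : dist (((i:ℝ) + j * η) * δ) 0 < ρ := by
        rw [Real.dist_0_eq_abs]
        refine h4.trans_lt ?_
        rw [mul_comm]
        exact (lt_div_iff₀ hY0).mp hδ.2
      have h6 := h2 h5
      rw [Real.norm_eq_abs, Real.norm_of_nonneg (by positivity)] at h6
      refine h6.trans ?_
      calc ε / (2 * Y ^ s) * |((i:ℝ) + j * η) * δ| ^ s ≤ ε / (2 * Y ^ s) * (Y * δ) ^ s := by
            gcongr
        _ = ε / 2 * δ ^ s := by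
            rw [Real.mul_rpow hY0.le hδ.1.le]
            field_simp
    rw [Real.dist_0_eq_abs, abs_div, abs_of_pos hδs, div_lt_iff₀ hδs]
    nlinarith
  simp only [Rq_eq_sum hc, neg_div, Finset.sum_div]
  suffices h : Tendsto (fun δ => ∑ j ∈ Finset.Icc (-(L:ℤ)) L,
      c j * ((j:ℝ) ^ q * taylorWeight q fun η => r ((i + j * η) * δ)) / δ ^ s)
      (nhdsWithin 0 (Set.Ioi 0)) (nhds (∑ _j ∈ Finset.Icc (-(L:ℤ)) L, 0)) by
    simpa using h.neg
  refine tendsto_finsetSum _ fun j _ => ?_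
  have := (hW j).const_mul (c j * (j:ℝ) ^ q)
  rw [mul_zero] at this
  refine this.congr fun δ => ?_
  ring

theorem eventually_cofinite_lt_abs_intCast (B : ℝ) :
    ∀ᶠ i : ℤ in cofinite, B < |(i:ℝ)| := by
  have h : {i : ℤ | ¬ B < |(i:ℝ)|} ⊆ Set.Icc (-⌈B⌉) ⌈B⌉ := by
    intro i hi
    have h1 : |(i:ℝ)| ≤ ⌈B⌉ := (not_lt.mp hi).trans (Int.le_ceil B)
    exact abs_le.mp (by exact_mod_cast h1)
  exact (Set.finite_Icc _ _).subset h

theorem summable_sq_of_abs_le_rpow {g : ℤ → ℝ} {A B β : ℝ} (hβ : β < -(1 / 2))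
    (hg : ∀ i : ℤ, B < |(i:ℝ)| → |g i| ≤ A * |(i:ℝ)| ^ β) : Summable fun i => g i ^ 2 := by
  have h1 := (Real.summable_abs_int_rpow (b := -(2 * β)) (by linarith)).mul_left (A ^ 2)
  refine h1.of_norm_bounded_eventually ?_
  filter_upwards [eventually_cofinite_lt_abs_intCast B] with i hi
  rw [Real.norm_eq_abs, abs_pow, neg_neg, mul_comm 2 β, Real.rpow_mul (abs_nonneg _), Real.rpow_two,
    ← mul_pow]
  exact pow_le_pow_left₀ (abs_nonneg _) (hg i hi) 2

/-- The Riemann-type limit of the weighted sums of squares over growing windows. -/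
theorem tendsto_window_sum {L : ℕ} (hL : 1 ≤ L) {x : ℕ → ℤ → ℝ} {z bnd : ℤ → ℝ}
    (hlim : ∀ i, Tendsto (fun n => x n i) atTop (nhds (z i)))
    (hbnd : Summable fun i => bnd i ^ 2) (hle : ∀ᶠ n in atTop, ∀ i, |x n i| ≤ bnd i) :
    Tendsto (fun n : ℕ =>
        ∑ i ∈ Finset.Icc (-(((n - L + 1 : ℕ) : ℤ) - 1)) (((n - L + 1 : ℕ) : ℤ) - 1),
          (((n - L + 1 : ℕ) : ℝ) - |(i : ℝ)|) / n * x n i ^ 2)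
      atTop (nhds (∑' i, z i ^ 2)) := by
  set S : ℕ → Finset ℤ := fun n =>
    Finset.Icc (-(((n - L + 1 : ℕ) : ℤ) - 1)) (((n - L + 1 : ℕ) : ℤ) - 1) with hS
  set F : ℕ → ℤ → ℝ := fun n i =>
    if i ∈ S n then (((n - L + 1 : ℕ) : ℝ) - |(i : ℝ)|) / n * x n i ^ 2 else 0 with hF
  have hsum : ∀ n, ∑ i ∈ S n, (((n - L + 1 : ℕ) : ℝ) - |(i : ℝ)|) / n * x n i ^ 2
      = ∑' i, F n i := by
    intro n
    rw [tsum_eq_sum (s := S n) fun i hi => by simp only [hF, if_neg hi]]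
    exact Finset.sum_congr rfl fun i hi => by simp only [hF, if_pos hi]
  refine Tendsto.congr (fun n => (hsum n).symm) ?_
  refine tendsto_tsum_of_dominated_convergence hbnd ?_ ?_
  · intro i
    have h1 : Tendsto (fun n : ℕ => (1 - ((L:ℝ) - 1 + |(i:ℝ)|) / n) * x n i ^ 2) atTop
        (nhds ((1 - 0) * z i ^ 2)) :=
      (tendsto_const_nhds.sub (tendsto_const_div_atTop_nhds_zero_nat _)).mul ((hlim i).pow 2)
    rw [sub_zero, one_mul] at h1
    refine h1.congr' ?_
    filter_upwards [eventually_ge_atTop (L + i.natAbs + 1)] with n hn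
    have hi : i ∈ S n := by
      rw [hS, Finset.mem_Icc]
      omega
    have hn0 : (n:ℝ) ≠ 0 := by
      have : n ≠ 0 := by omega
      exact_mod_cast this
    simp only [hF, if_pos hi]
    rw [Nat.cast_add, Nat.cast_sub (by omega)]
    push_cast
    field_simp
    ring
  · filter_upwards [hle, eventually_ge_atTop L] with n hn hnL i
    have hsq : x n i ^ 2 ≤ bnd i ^ 2 := sq_le_sq' (abs_le.mp (hn i)).1 (abs_le.mp (hn i)).2
    simp only [hF]
    split_ifs with hi
    · rw [hS, Finset.mem_Icc] at hi
      have hn0 : (0:ℝ) < n := by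
        have : 0 < n := by omega
        exact_mod_cast this
      have h1 : |(i:ℝ)| ≤ ((n - L + 1 : ℕ) : ℝ) := by
        have : |i| ≤ ((n - L + 1 : ℕ) : ℤ) := by
          rw [abs_le]
          omega
        exact_mod_cast this
      have h2 : ((n - L + 1 : ℕ) : ℝ) ≤ n := by
        have : n - L + 1 ≤ n := by omega
        exact_mod_cast this
      have h3 : (((n - L + 1 : ℕ) : ℝ) - |(i : ℝ)|) / n ≤ 1 := by
        rw [div_le_one hn0]
        linarith [abs_nonneg (i:ℝ)]
      have h4 : 0 ≤ (((n - L + 1 : ℕ) : ℝ) - |(i : ℝ)|) / n :=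
        div_nonneg (sub_nonneg.mpr h1) hn0.le
      rw [Real.norm_of_nonneg (mul_nonneg h4 (sq_nonneg _))]
      exact (mul_le_of_le_one_left (sq_nonneg _) h3).trans hsq
    · rw [norm_zero]
      positivity

/-- Uniform square-summable domination of the remainder kernels as `δ → 0`. -/
theorem exists_summable_bound_Rq_div_rpow {c : ℤ → ℝ} {L : ℕ}
    (hc : ∀ j, c j ≠ 0 → j ∈ Finset.Icc (-(L:ℤ)) L) {r : ℝ → ℝ} {s β K : ℝ} {q d : ℕ}
    (hs : 0 < s) (hmom : ∀ n < q + d, ∑ j ∈ Finset.Icc (-(L:ℤ)) L, c j * (j : ℝ) ^ n = 0)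
    (hr : r =o[nhds (0:ℝ)] fun h => |h| ^ s) (hrd : ContDiffOn ℝ d r {(0:ℝ)}ᶜ)
    (hβ : s - d < β) (hβ' : β < -(1 / 2)) (hK : 0 ≤ K)
    (hrK : ∀ h ≠ 0, |iteratedDeriv d r h| ≤ K * |h| ^ β) :
    ∃ e : ℤ → ℝ, (Summable fun i => e i ^ 2) ∧
      ∀ᶠ δ in nhdsWithin 0 (Set.Ioi 0), ∀ i, |Rq i δ q r c / δ ^ s| ≤ e i := by
  obtain ⟨A, hA, hAr⟩ := abs_Rq_le_of_moments_eq_zero hc hmom hrd hK (by linarith) hrK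
  refine ⟨fun i => if 2 * (L:ℝ) < |(i:ℝ)| then A * |(i:ℝ)| ^ β else 1,
    summable_sq_of_abs_le_rpow hβ' (A := A) (B := 2 * L) fun i hi => ?_, ?_⟩
  · rw [if_pos hi, abs_of_nonneg (by positivity)]
  · have hfin : {i : ℤ | ¬ 2 * (L:ℝ) < |(i:ℝ)|}.Finite := eventually_cofinite_lt_abs_intCast _
    have h1 : ∀ᶠ δ in nhdsWithin (0:ℝ) (Set.Ioi 0), ∀ i ∈ {i : ℤ | ¬ 2 * (L:ℝ) < |(i:ℝ)|},
        |Rq i δ q r c / δ ^ s| ≤ 1 := by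
      rw [eventually_all_finite hfin]
      intro i _
      have h2 := (tendsto_Rq_div_rpow hc hs hr i q).abs
      rw [abs_zero] at h2
      exact h2.eventually (ge_mem_nhds zero_lt_one)
    filter_upwards [h1, Ioo_mem_nhdsGT (zero_lt_one (α := ℝ))] with δ hδ hδ' i
    split_ifs with hi
    · have hδs : 0 < δ ^ s := Real.rpow_pos_of_pos hδ'.1 s
      rw [abs_div, abs_of_pos hδs, div_le_iff₀ hδs]
      refine (hAr i δ hδ'.1 hi).trans ?_
      refine mul_le_mul_of_nonneg_left ?_ (by positivity)
      exact Real.rpow_le_rpow_of_exponent_ge hδ'.1 hδ'.2.le (by linarith)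
    · exact hδ i hi

/-- under (H0)–(H2), `δ_n = n^{−α}`, and a variation sequence `a` of length
`L` and order `M > D + s/2 + 1/4`, the series `Σ_{i∈ℤ} R(i,1,2D,|·|^s,a^{2*})²` is finite
and positive, and the variance `W_n = 2 Σ_{|i|<n'} (n'−|i|)(Σ_j (a^{2*})_j V((i+j)δ_n))²`
of the quadratic `a`-variation satisfies
`W_n / (2 n C² δ_n^{4D+2s} Σ_{i∈ℤ} R(i,1,2D,|·|^s,a^{2*})²) → 1`. -/
theorem stmt_7 (V r : ℝ → ℝ) (D : ℕ) (C s α : ℝ)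
    (hC : 0 < C) (hs0 : 0 < s) (hs2 : s < 2) (hα0 : 0 < α) (hα1 : α ≤ 1)
    -- (H0)
    (hEven : ∀ h : ℝ, V (-h) = V h) (hSmooth : ContDiffOn ℝ (⊤ : ℕ∞) V (Set.Ioi 0))
    -- (H1)
    (hV2D : ContDiff ℝ ((2 * D : ℕ) : ℕ∞) V)
    (hExp : ∀ h : ℝ, iteratedDeriv (2 * D) V h
      = iteratedDeriv (2 * D) V 0 + C * (-1 : ℝ) ^ D * |h| ^ s + r h)
    (hro : r =o[nhds (0:ℝ)] fun h => |h| ^ s)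
    -- (H2), with d = 2 if s < 3/2 and d = 3 otherwise
    (hrd : ContDiffOn ℝ ((if s < 3/2 then 2 else 3 : ℕ) : ℕ∞) r {(0:ℝ)}ᶜ)
    (hH2 : ∃ β K : ℝ, s - (if s < 3/2 then 2 else 3 : ℕ) < β ∧ β < -(1/2) ∧ 0 < K ∧
      (∀ h : ℝ, h ≠ 0 → |iteratedDeriv (if s < 3/2 then 2 else 3 : ℕ) r h| ≤ K * |h| ^ β) ∧
      (∀ h : ℝ, 1 < |h| → |r h| ≤ K * |h| ^ s))
    -- variation sequence of length L and order M
    (a : ℤ → ℝ) (L M : ℕ) (hL : 1 ≤ L) (hM : 1 ≤ M)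
    (hsupp : ∀ j : ℤ, a j ≠ 0 → 0 ≤ j ∧ j ≤ (L : ℤ) - 1)
    (ha0 : a 0 ≠ 0) (haL : a ((L : ℤ) - 1) ≠ 0)
    (hmom : ∀ k : ℕ, k < M → ∑ᶠ j : ℤ, a j * (j : ℝ) ^ k = 0)
    (hmomM : ∑ᶠ j : ℤ, a j * (j : ℝ) ^ M ≠ 0)
    (hMD : (D : ℝ) + s / 2 + 1 / 4 < M) :
    Summable (fun i : ℤ => (Rq i 1 (2 * D) (fun x => |x| ^ s) (seqConv a a)) ^ 2)
    ∧
    0 < ∑' i : ℤ, (Rq i 1 (2 * D) (fun x => |x| ^ s) (seqConv a a)) ^ 2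
    ∧
    Tendsto (fun n : ℕ =>
        (2 * ∑ i ∈ Finset.Icc (-(((n - L + 1 : ℕ) : ℤ) - 1)) (((n - L + 1 : ℕ) : ℤ) - 1),
            (((n - L + 1 : ℕ) : ℝ) - |(i : ℝ)|) *
              (∑ᶠ j : ℤ, seqConv a a j * V ((i + j) * (n : ℝ) ^ (-α))) ^ 2)
        / (2 * (n : ℝ) * C ^ 2 * ((n : ℝ) ^ (-α)) ^ (4 * (D : ℝ) + 2 * s)
            * ∑' i : ℤ, (Rq i 1 (2 * D) (fun x => |x| ^ s) (seqConv a a)) ^ 2))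
      atTop (nhds 1) := by
  obtain ⟨β, K, hβ, hβ', hK, hrK, -⟩ := hH2
  obtain ⟨d, hd⟩ : ∃ d : ℕ, d = if s < 3 / 2 then 2 else 3 := ⟨_, rfl⟩
  rw [← hd] at hrd hβ hrK
  have hDM : D < M := by
    have : (D:ℝ) < M := by linarith
    exact_mod_cast this
  have hdM : 2 * D + d ≤ 2 * M := by
    split_ifs at hd with h
    · omega
    · have : ((D + 1 : ℕ) : ℝ) < M := by
        push_cast
        linarith
      have : D + 1 < M := by exact_mod_cast this
      omega
  have hc : ∀ j, seqConv a a j ≠ 0 → j ∈ Finset.Icc (-(L:ℤ)) L := fun j hj => by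
    have := mem_Icc_of_seqConv_ne_zero hsupp j hj
    rw [Finset.mem_Icc]
    omega
  have hmomc : ∀ n < 2 * M, ∑ j ∈ Finset.Icc (-(L:ℤ)) L, seqConv a a j * (j : ℝ) ^ n = 0 :=
    fun n hn => sum_seqConv_mul_pow_eq_zero hsupp hmom hn
  set R : ℤ → ℝ := fun i => Rq i 1 (2 * D) (fun x => |x| ^ s) (seqConv a a) with hR
  have hRsum : Summable fun i => R i ^ 2 := by
    obtain ⟨A, -, hA⟩ := abs_Rq_le_of_moments_eq_zero hc
      (fun n hn => hmomc n (hn.trans_le hdM)) (contDiffOn_abs_rpow s d)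
      (abs_nonneg ((descPochhammer ℝ d).eval s)) (by linarith : s - d ≤ 0)
      (fun h hh => (abs_iteratedDeriv_abs_rpow s d hh).le)
    refine summable_sq_of_abs_le_rpow (A := A) (B := 2 * L) (β := s - d) (by linarith)
      fun i hi => ?_
    simpa using hA i 1 one_pos hi
  have hRpos : 0 < ∑' i, R i ^ 2 := by
    obtain ⟨i, hi⟩ := exists_Rq_seqConv_ne_zero hs0 hs2 hDM hsupp ha0 haL hmom hmomM
    exact hRsum.tsum_pos (fun i => sq_nonneg _) i (by positivity)
  refine ⟨hRsum, hRpos, ?_⟩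
  obtain ⟨e, hesum, he⟩ := exists_summable_bound_Rq_div_rpow hc hs0
    (fun n hn => hmomc n (hn.trans_le hdM)) hro hrd hβ (by linarith) hK.le hrK
  set δ : ℕ → ℝ := fun n => (n:ℝ) ^ (-α) with hδ
  have hδ0 : Tendsto δ atTop (nhdsWithin 0 (Set.Ioi 0)) := by
    rw [tendsto_nhdsWithin_iff]
    refine ⟨(tendsto_rpow_neg_atTop hα0).comp tendsto_natCast_atTop_atTop, ?_⟩
    filter_upwards [eventually_gt_atTop 0] with n hn
    exact Real.rpow_pos_of_pos (by exact_mod_cast hn) _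
  set b : ℝ := C * (-1) ^ D with hb
  have hb2 : b ^ 2 = C ^ 2 := by
    rw [hb, mul_pow, ← pow_mul, mul_comm D 2, pow_mul]
    simp
  set x : ℕ → ℤ → ℝ := fun n i => b * R i + Rq i (δ n) (2 * D) r (seqConv a a) / δ n ^ s with hx
  have hlim : ∀ i, Tendsto (fun n => x n i) atTop (nhds (b * R i)) := by
    intro i
    have := ((tendsto_Rq_div_rpow hc hs0 hro i (2 * D)).comp hδ0).const_add (b * R i)
    rwa [add_zero] at this
  have hbnd : Summable fun i => (|b * R i| + e i) ^ 2 := by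
    refine Summable.of_nonneg_of_le (fun i => sq_nonneg _) (fun i => ?_)
      ((hRsum.mul_left (2 * b ^ 2)).add (hesum.mul_left 2))
    have h1 : |b * R i| ^ 2 = b ^ 2 * R i ^ 2 := by rw [sq_abs, mul_pow]
    nlinarith [sq_nonneg (|b * R i| - e i)]
  have hle : ∀ᶠ n in atTop, ∀ i, |x n i| ≤ |b * R i| + e i := by
    filter_upwards [hδ0.eventually he] with n hn i
    exact (abs_add_le _ _).trans (add_le_add_right (hn i) _)
  have hmain := (tendsto_window_sum hL hlim hbnd hle).div_const (C ^ 2 * ∑' i, R i ^ 2)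
  have hT : ∑' i, (b * R i) ^ 2 = C ^ 2 * ∑' i, R i ^ 2 := by
    simp only [mul_pow, tsum_mul_left, hb2]
  rw [hT, div_self (by positivity)] at hmain
  refine hmain.congr' ?_
  filter_upwards [eventually_gt_atTop 0] with n hn
  have hn0 : (0:ℝ) < n := by exact_mod_cast hn
  have hδn : 0 < δ n := Real.rpow_pos_of_pos hn0 _
  have hpow : δ n ^ (4 * (D:ℝ) + 2 * s) = (δ n ^ (2 * D) * δ n ^ s) ^ 2 := by
    rw [← Real.rpow_natCast (δ n) (2 * D), ← Real.rpow_add hδn, ← Real.rpow_mul_natCast hδn.le]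
    congr 1
    push_cast
    ring
  have hδs : 0 < δ n ^ s := Real.rpow_pos_of_pos hδn s
  have hS : ∀ i : ℤ, (∑ᶠ j : ℤ, seqConv a a j * V ((i + j) * δ n)) ^ 2
      = δ n ^ (4 * (D:ℝ) + 2 * s) * x n i ^ 2 := by
    intro i
    rw [finsum_mul_eq_Rq (b := b) (v := iteratedDeriv (2 * D) V 0) hc hs0 (by exact_mod_cast hV2D)
      hExp (fun n hn => hmomc n (by omega)) i hδn, hpow, hx, ← mul_pow]
    simp only
    rw [neg_mul, neg_sq]
    congr 1
    field_simp
    rfl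
  have hP : 0 < δ n ^ (4 * (D:ℝ) + 2 * s) := Real.rpow_pos_of_pos hδn _
  have hnum : 2 * ∑ i ∈ Finset.Icc (-(((n - L + 1 : ℕ) : ℤ) - 1)) (((n - L + 1 : ℕ) : ℤ) - 1),
      (((n - L + 1 : ℕ) : ℝ) - |(i : ℝ)|) *
        (∑ᶠ j : ℤ, seqConv a a j * V ((i + j) * δ n)) ^ 2
      = (2 * n * δ n ^ (4 * (D:ℝ) + 2 * s)) *
        ∑ i ∈ Finset.Icc (-(((n - L + 1 : ℕ) : ℤ) - 1)) (((n - L + 1 : ℕ) : ℤ) - 1),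
          (((n - L + 1 : ℕ) : ℝ) - |(i : ℝ)|) / n * x n i ^ 2 := by
    rw [Finset.mul_sum, Finset.mul_sum]
    refine Finset.sum_congr rfl fun i _ => ?_
    rw [hS]
    field_simp
  rw [hnum]
  change _ = _ / (2 * (n:ℝ) * C ^ 2 * δ n ^ (4 * (D:ℝ) + 2 * s) * ∑' i, R i ^ 2)
  have hk : (2 * (n:ℝ) * δ n ^ (4 * (D:ℝ) + 2 * s)) ≠ 0 := by positivity
  rw [← mul_div_mul_left _ _ hk]
  congr 1
  ring
end
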